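/- arXiv:1803.01606 — 5 statements merged into one kernel-verified Lean document; each statement's English description precedes it below -/
import Mathlib

section
/- Let g : U → ℝ be a nonnegative C² function on an open subset U of ℝ^k. For every compact subset K of U there exists a constant c₁ > 0 such that ‖∇g(x)‖² ≤ c₁ · g(x) for every x ∈ K. -/
open Set

section

variable {E : Type*} [NormedAddCommGroup E] [InnerProductSpace ℝ E] [CompleteSpace E]

lemma norm_gradient (g : E → ℝ) (x : E) : ‖gradient g x‖ = ‖fderiv ℝ g x‖ := by
  simp [gradient]

lemma fderiv_apply_gradient (g : E → ℝ) (x : E) :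
    fderiv ℝ g x (gradient g x) = ‖gradient g x‖ ^ 2 := by
  rw [← real_inner_self_eq_norm_sq]
  nth_rw 2 [gradient]
  exact (InnerProductSpace.toDual_symm_apply).symm

/-- A gradient step of length at most `r` along which the function stays nonnegative bounds
the squared norm of the gradient by the value of the function. -/
lemma norm_gradient_sq_le_of_step {g : E → ℝ} {x : E} {r L t : ℝ}
    (hd : ∀ y ∈ Metric.ball x r, DifferentiableAt ℝ g y)
    (hL : ∀ y ∈ Metric.ball x r, ‖fderiv ℝ g y - fderiv ℝ g x‖ ≤ L * ‖y - x‖)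
    (h_nonneg : ∀ y ∈ Metric.ball x r, 0 ≤ g y) (hL0 : 0 ≤ L) (ht : 0 < t)
    (htL : t * L ≤ 1 / 2) (htr : t * ‖gradient g x‖ < r) :
    ‖gradient g x‖ ^ 2 ≤ 2 / t * g x := by
  set v := gradient g x with hv
  have hsub : Metric.closedBall x (t * ‖v‖) ⊆ Metric.ball x r :=
    Metric.closedBall_subset_ball htr
  have hy : x - t • v ∈ Metric.closedBall x (t * ‖v‖) := by
    simp [norm_smul, abs_of_pos ht]
  have hx : x ∈ Metric.closedBall x (t * ‖v‖) :=
    Metric.mem_closedBall_self (by positivity)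
  have key := (convex_closedBall x (t * ‖v‖)).norm_image_sub_le_of_norm_fderiv_le'
    (𝕜 := ℝ) (f := g) (φ := fderiv ℝ g x) (C := L * (t * ‖v‖))
    (fun y hy => hd y (hsub hy))
    (fun y hy => (hL y (hsub hy)).trans
      (mul_le_mul_of_nonneg_left (mem_closedBall_iff_norm.1 hy) hL0)) hx hy
  have hn : ‖x - t • v - x‖ = t * ‖v‖ := by simp [norm_smul, abs_of_pos ht]
  have hφ : fderiv ℝ g x (x - t • v - x) = -(t * ‖v‖ ^ 2) := by
    rw [sub_sub_cancel_left, map_neg, map_smul, hv, fderiv_apply_gradient, smul_eq_mul]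
  rw [hn, hφ, Real.norm_eq_abs] at key
  have h1 := (abs_le.1 key).2
  have h2 := h_nonneg _ (hsub hy)
  have h3 : (t * L) * (t * ‖v‖ ^ 2) ≤ 1 / 2 * (t * ‖v‖ ^ 2) :=
    mul_le_mul_of_nonneg_right htL (by positivity)
  rw [div_mul_eq_mul_div, le_div_iff₀ ht]
  linarith

lemma exists_nhds_norm_gradient_sq_le {g : E → ℝ} {U : Set E} (hU : IsOpen U)
    (hg : ContDiffOn ℝ 2 g U) (hg_nonneg : ∀ x ∈ U, 0 ≤ g x) {a : E} (ha : a ∈ U) :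
    ∃ c > (0 : ℝ), ∃ s ∈ nhds a, ∀ x ∈ s, ‖gradient g x‖ ^ 2 ≤ c * g x := by
  have hga : ContDiffAt ℝ 1 (fderiv ℝ g) a :=
    (hg.contDiffAt (hU.mem_nhds ha)).fderiv_right (by norm_num)
  obtain ⟨L, s, hs, hL⟩ := hga.exists_lipschitzOnWith
  obtain ⟨ε, hε, hball⟩ := Metric.mem_nhds_iff.1 (Filter.inter_mem hs (hU.mem_nhds ha))
  set r := ε / 2 with hr
  have hr0 : 0 < r := by positivity
  set M := ‖fderiv ℝ g a‖ + L * r with hM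
  have hM0 : 0 ≤ M := by positivity
  set t := min (1 / (2 * ((L : ℝ) + 1))) (r / (M + 1)) with ht
  have ht0 : 0 < t := by positivity
  refine ⟨2 / t, by positivity, Metric.ball a r, Metric.ball_mem_nhds a hr0, fun x hx => ?_⟩
  have hsub : Metric.ball x r ⊆ s ∩ U :=
    (Metric.ball_subset_ball' (by linarith [Metric.mem_ball.1 hx])).trans hball
  have hxs : x ∈ s := (hsub (Metric.mem_ball_self hr0)).1
  have has : a ∈ s := mem_of_mem_nhds hs
  have hMx : ‖gradient g x‖ ≤ M := by
    rw [norm_gradient]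
    have h1 : ‖fderiv ℝ g x - fderiv ℝ g a‖ ≤ L * ‖x - a‖ := hL.norm_sub_le hxs has
    have h2 : (L : ℝ) * ‖x - a‖ ≤ L * r :=
      mul_le_mul_of_nonneg_left (mem_ball_iff_norm.1 hx).le L.2
    linarith [norm_le_norm_add_norm_sub' (fderiv ℝ g x) (fderiv ℝ g a)]
  refine norm_gradient_sq_le_of_step (r := r) (L := L) (fun y hy => ?_)
    (fun y hy => hL.norm_sub_le (hsub hy).1 hxs) (fun y hy => hg_nonneg y (hsub hy).2)
    L.2 ht0 ?_ ?_
  · exact (hg.contDiffAt (hU.mem_nhds (hsub hy).2)).differentiableAt (by norm_num)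
  · have h1 : t ≤ 1 / (2 * ((L : ℝ) + 1)) := min_le_left _ _
    rw [le_div_iff₀ (by positivity)] at h1
    linarith
  · have h1 : t ≤ r / (M + 1) := min_le_right _ _
    rw [le_div_iff₀ (by positivity)] at h1
    have h2 : t * ‖gradient g x‖ ≤ t * M := mul_le_mul_of_nonneg_left hMx ht0.le
    linarith

end

/-- Let `g : U → ℝ` be a nonnegative `C²` function on an open subset `U` of
`ℝ^k`. For every compact subset `K` of `U` there exists a constant `c₁ > 0` such that
`‖∇g(x)‖² ≤ c₁ · g(x)` for every `x ∈ K`. -/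
theorem stmt_2 (k : ℕ) (U : Set (EuclideanSpace ℝ (Fin k))) (hU : IsOpen U)
    (g : EuclideanSpace ℝ (Fin k) → ℝ)
    (hg : ContDiffOn ℝ 2 g U) (hg_nonneg : ∀ x ∈ U, 0 ≤ g x)
    (K : Set (EuclideanSpace ℝ (Fin k))) (hK : IsCompact K) (hKU : K ⊆ U) :
    ∃ c₁ > (0 : ℝ), ∀ x ∈ K, ‖gradient g x‖ ^ 2 ≤ c₁ * g x := by
  suffices h : ∃ c₁ > (0 : ℝ), ∀ x ∈ K, x ∈ U → ‖gradient g x‖ ^ 2 ≤ c₁ * g x by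
    obtain ⟨c, hc, h⟩ := h
    exact ⟨c, hc, fun x hx => h x hx (hKU hx)⟩
  refine hK.induction_on
    (p := fun S => ∃ c > (0 : ℝ), ∀ x ∈ S, x ∈ U → ‖gradient g x‖ ^ 2 ≤ c * g x)
    ⟨1, one_pos, by simp⟩ ?_ ?_ ?_
  · rintro S T hST ⟨c, hc, h⟩
    exact ⟨c, hc, fun x hx => h x (hST hx)⟩
  · rintro S T ⟨c, hc, hS⟩ ⟨d, hd, hT⟩
    refine ⟨max c d, lt_max_of_lt_left hc, fun x hx hxU => ?_⟩
    rcases hx with hx | hx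
    · exact (hS x hx hxU).trans
        (mul_le_mul_of_nonneg_right (le_max_left c d) (hg_nonneg x hxU))
    · exact (hT x hx hxU).trans
        (mul_le_mul_of_nonneg_right (le_max_right c d) (hg_nonneg x hxU))
  · intro a ha
    obtain ⟨c, hc, s, hs, h⟩ := exists_nhds_norm_gradient_sq_le hU hg hg_nonneg (hKU ha)
    exact ⟨s, mem_nhdsWithin_of_mem_nhds hs, c, hc, fun x hx _ => h x hx⟩
end

section
/- Let g : U → ℝ be a nonnegative C² function on an open subset U of ℝ^k. If there exists z ∈ U with g(z) = 0 such that the second derivative D²g(z) is positive definite, then there exist a constant c₃ > 0 and a neighborhood W of z in U such that ‖∇g(x)‖² ≥ c₃ · g(x) for every x ∈ W. -/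
open Set

open Filter Topology Asymptotics in
/-- If the derivative of `f` vanishes at `z` and is differentiable there, then `f` deviates from
`f z` at most quadratically. -/
theorem isBigO_sub_sq_of_hasFDerivAt_fderiv {E : Type*} [NormedAddCommGroup E] [NormedSpace ℝ E]
    {f : E → ℝ} {z : E} {H : E →L[ℝ] E →L[ℝ] ℝ} (hf : ∀ᶠ x in 𝓝 z, DifferentiableAt ℝ f x)
    (hfz : fderiv ℝ f z = 0) (hH : HasFDerivAt (fderiv ℝ f) H z) :
    (fun x => f x - f z) =O[𝓝 z] fun x => ‖x - z‖ ^ 2 := by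
  obtain ⟨C, hC, hbound⟩ := hH.isBigO_sub.exists_pos
  obtain ⟨ε, hε, hball⟩ := Metric.eventually_nhds_iff_ball.1 (hf.and hbound.bound)
  refine IsBigO.of_bound C ?_
  filter_upwards [Metric.ball_mem_nhds z hε] with x hx
  have hsub : Metric.closedBall z ‖x - z‖ ⊆ Metric.ball z ε :=
    Metric.closedBall_subset_ball (by simpa [dist_eq_norm] using hx)
  have hderiv : ∀ y ∈ Metric.closedBall z ‖x - z‖, ‖fderiv ℝ f y‖ ≤ C * ‖x - z‖ := by
    intro y hy
    have hy' := (hball y (hsub hy)).2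
    rw [hfz, sub_zero] at hy'
    rw [mem_closedBall_iff_norm] at hy
    exact hy'.trans (by gcongr)
  have hmvt := (convex_closedBall z ‖x - z‖).norm_image_sub_le_of_norm_fderiv_le
    (fun y hy => (hball y (hsub hy)).1) hderiv
    (Metric.mem_closedBall_self (norm_nonneg _)) (mem_closedBall_iff_norm.2 (le_refl ‖x - z‖))
  rw [norm_pow, norm_norm]
  linarith

open Filter Topology Asymptotics in
/-- At a nondegenerate critical point, the deviation of `f` is controlled by the square of the
norm of its derivative. -/
theorem isBigO_sub_sq_norm_fderiv {E : Type*} [NormedAddCommGroup E] [NormedSpace ℝ E]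
    [FiniteDimensional ℝ E] {f : E → ℝ} {z : E} {H : E →L[ℝ] E →L[ℝ] ℝ}
    (hf : ∀ᶠ x in 𝓝 z, DifferentiableAt ℝ f x) (hfz : fderiv ℝ f z = 0)
    (hH : HasFDerivAt (fderiv ℝ f) H z) (hinj : Function.Injective H) :
    (fun x => f x - f z) =O[𝓝 z] fun x => ‖fderiv ℝ f x‖ ^ 2 := by
  obtain ⟨K, -, hK⟩ := H.toLinearMap.exists_antilipschitzWith (LinearMap.ker_eq_bot.2 hinj)
  have hrev := (hH.isTheta_sub (hK.isUniformInducing H.uniformContinuous).isInducing).isBigO_symm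
  simp only [hfz, sub_zero] at hrev
  exact (isBigO_sub_sq_of_hasFDerivAt_fderiv hf hfz hH).trans (hrev.norm_norm.pow 2)

/-- Let `g : U → ℝ` be a nonnegative `C²` function on an open subset `U` of
`ℝ^k`. If there exists `z ∈ U` with `g(z) = 0` such that the second derivative `D²g(z)` is
positive definite, then there exist a constant `c₃ > 0` and a neighborhood `W` of `z` in `U`
such that `‖∇g(x)‖² ≥ c₃ · g(x)` for every `x ∈ W`. -/
theorem stmt_3 (k : ℕ) (U : Set (EuclideanSpace ℝ (Fin k))) (hU : IsOpen U)
    (g : EuclideanSpace ℝ (Fin k) → ℝ)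
    (hg : ContDiffOn ℝ 2 g U) (hg_nonneg : ∀ x ∈ U, 0 ≤ g x)
    (z : EuclideanSpace ℝ (Fin k)) (hzU : z ∈ U) (hgz : g z = 0)
    (hposdef : ∀ v : EuclideanSpace ℝ (Fin k), v ≠ 0 → 0 < iteratedFDeriv ℝ 2 g z ![v, v]) :
    ∃ c₃ > (0 : ℝ), ∃ W ∈ nhds z, W ⊆ U ∧ ∀ x ∈ W, c₃ * g x ≤ ‖gradient g x‖ ^ 2 := by
  have hUz : U ∈ nhds z := hU.mem_nhds hzU
  have hdiff : ∀ᶠ x in nhds z, DifferentiableAt ℝ g x := by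
    filter_upwards [hUz] with x hx
    exact (hg.contDiffAt (hU.mem_nhds hx)).differentiableAt (by norm_num)
  have hmin : IsLocalMin g z := by
    filter_upwards [hUz] with x hx
    exact hgz.trans_le (hg_nonneg x hx)
  have hH : DifferentiableAt ℝ (fderiv ℝ g) z :=
    ((hg.contDiffAt hUz).fderiv_right (m := 1) (by norm_num)).differentiableAt (by norm_num)
  have hinj : Function.Injective (fderiv ℝ (fderiv ℝ g) z) := by
    refine (injective_iff_map_eq_zero _).2 fun v hv => ?_
    by_contra hne
    have hpos := hposdef v hne
    simp [iteratedFDeriv_two_apply, hv] at hpos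
  obtain ⟨C, hC, hbound⟩ :=
    (isBigO_sub_sq_norm_fderiv hdiff hmin.fderiv_eq_zero hH.hasFDerivAt hinj).exists_pos
  refine ⟨C⁻¹, inv_pos.2 hC, _, Filter.inter_mem hUz hbound.bound, inter_subset_left, ?_⟩
  rintro x ⟨-, hx⟩
  have hx : ‖g x - g z‖ ≤ C * ‖‖fderiv ℝ g x‖ ^ 2‖ := hx
  rw [hgz, sub_zero, norm_pow, norm_norm] at hx
  rw [gradient, LinearIsometryEquiv.norm_map, inv_mul_le_iff₀ hC]
  exact (Real.le_norm_self _).trans hx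
end

section
/- For every r > 0 there exists a constant c₁ > 0 such that ‖∇ψ_{G,d}(p)‖² ≤ c₁ · ψ_{G,d}(p) for every p in the sublevel set ψ_{G,d}^{-1}(≤ r). -/
open Set

noncomputable section

/-- The configuration space of `N` point agents in `ℝⁿ`, i.e. `ℝ^{nN}` with the Euclidean
inner product. -/
abbrev Cfg (n N : ℕ) := PiLp 2 (fun _ : Fin N => EuclideanSpace ℝ (Fin n))

/-- The potential function `ψ_{G,d}(p) = (1/4) Σ_{ij∈E} (‖p_j − p_i‖² − d_{ij}²)²`, where the
graph `G` has `M` edges, the `m`-th edge joining the (distinct) vertices `a m` and `b m`. -/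
def psiG {n N M : ℕ} (a b : Fin M → Fin N) (d : Fin M → ℝ) (p : Cfg n N) : ℝ :=
  (1 / 4) * ∑ m : Fin M, (‖p (b m) - p (a m)‖ ^ 2 - d m ^ 2) ^ 2

theorem HasFDerivAt.norm_gradient {E : Type*} [NormedAddCommGroup E] [InnerProductSpace ℝ E]
    [CompleteSpace E] {f : E → ℝ} {D : E →L[ℝ] ℝ} {x : E} (h : HasFDerivAt f D x) :
    ‖gradient f x‖ = ‖D‖ := by
  rw [gradient, LinearIsometryEquiv.norm_map, h.fderiv]

theorem norm_apply_sub_apply_le {n N : ℕ} (i j : Fin N) (v : Cfg n N) :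
    ‖v j - v i‖ ≤ 2 * ‖v‖ := by
  have h1 := PiLp.norm_apply_le v i
  have h2 := PiLp.norm_apply_le v j
  linarith [norm_sub_le (v j) (v i)]

theorem hasFDerivAt_psiG {n N M : ℕ} (a b : Fin M → Fin N) (d : Fin M → ℝ) (p : Cfg n N) :
    ∃ D : Cfg n N →L[ℝ] ℝ, HasFDerivAt (psiG a b d) D p ∧
      ∀ v, D v = ∑ m, (‖p (b m) - p (a m)‖ ^ 2 - d m ^ 2) *
        inner ℝ (p (b m) - p (a m)) (v (b m) - v (a m)) := by
  let L (m : Fin M) : Cfg n N →L[ℝ] EuclideanSpace ℝ (Fin n) :=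
    PiLp.proj (𝕜 := ℝ) 2 (fun _ : Fin N => EuclideanSpace ℝ (Fin n)) (b m) -
      PiLp.proj (𝕜 := ℝ) 2 (fun _ : Fin N => EuclideanSpace ℝ (Fin n)) (a m)
  have h := (HasFDerivAt.fun_sum (u := Finset.univ) fun m _ =>
    (((L m).hasFDerivAt (x := p)).norm_sq.sub_const (d m ^ 2)).pow 2).const_mul (1 / 4 : ℝ)
  refine ⟨_, h, fun v => ?_⟩
  simp only [smul_apply, sum_apply, smul_eq_mul, Finset.mul_sum]
  refine Finset.sum_congr rfl fun m _ => ?_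
  simp [L, inner_sub_left, inner_sub_right]
  ring

theorem norm_gradient_psiG_le {n N M : ℕ} (a b : Fin M → Fin N) (d : Fin M → ℝ) (p : Cfg n N) :
    ‖gradient (psiG a b d) p‖ ≤
      2 * ∑ m, |‖p (b m) - p (a m)‖ ^ 2 - d m ^ 2| * ‖p (b m) - p (a m)‖ := by
  obtain ⟨D, hD, hDv⟩ := hasFDerivAt_psiG a b d p
  rw [hD.norm_gradient]
  refine D.opNorm_le_bound (by positivity) fun v => ?_
  rw [hDv, Finset.mul_sum, Finset.sum_mul]
  refine (norm_sum_le _ _).trans (Finset.sum_le_sum fun m _ => ?_)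
  rw [norm_mul, Real.norm_eq_abs]
  calc _ ≤ |‖p (b m) - p (a m)‖ ^ 2 - d m ^ 2| * (‖p (b m) - p (a m)‖ * (2 * ‖v‖)) := by
        gcongr
        refine (norm_inner_le_norm _ _).trans ?_
        gcongr
        exact norm_apply_sub_apply_le _ _ v
    _ = _ := by ring

/-- On a sublevel set the edge lengths are bounded. -/
theorem norm_sub_sq_le_of_psiG_le {n N M : ℕ} {a b : Fin M → Fin N} {d : Fin M → ℝ}
    {p : Cfg n N} {r : ℝ} (hp : psiG a b d p ≤ r) (m : Fin M) :
    ‖p (b m) - p (a m)‖ ^ 2 ≤ d m ^ 2 + 4 * r + 1 := by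
  have h := Finset.single_le_sum
    (f := fun m => (‖p (b m) - p (a m)‖ ^ 2 - d m ^ 2) ^ 2)
    (fun _ _ => sq_nonneg _) (Finset.mem_univ m)
  unfold psiG at hp
  dsimp only at h
  nlinarith [sq_nonneg (‖p (b m) - p (a m)‖ ^ 2 - d m ^ 2 - 1 / 2)]

/-- For every `r > 0` there exists a constant `c₁ > 0` such that
`‖∇ψ_{G,d}(p)‖² ≤ c₁ · ψ_{G,d}(p)` for every `p` in the sublevel set `ψ_{G,d}^{-1}(≤ r)`. -/
theorem stmt_4 {n N M : ℕ} (hn : 0 < n) (hN : 0 < N) (hM : 0 < M)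
    (a b : Fin M → Fin N) (hab : ∀ m, a m ≠ b m)
    (hinj : ∀ m m' : Fin M,
      ((a m = a m' ∧ b m = b m') ∨ (a m = b m' ∧ b m = a m')) → m = m')
    (d : Fin M → ℝ) (hd : ∀ m, 0 ≤ d m)
    (r : ℝ) (hr : 0 < r) :
    ∃ c₁ > (0 : ℝ), ∀ p : Cfg n N, psiG a b d p ≤ r →
      ‖gradient (psiG a b d) p‖ ^ 2 ≤ c₁ * psiG a b d p := by
  refine ⟨16 * ∑ m, (d m ^ 2 + 4 * r + 1) + 1, by positivity, fun p hp => ?_⟩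
  have hpsi : 0 ≤ psiG a b d p := by unfold psiG; positivity
  have hsum : ∑ m, (‖p (b m) - p (a m)‖ ^ 2 - d m ^ 2) ^ 2 = 4 * psiG a b d p := by
    unfold psiG; ring
  calc ‖gradient (psiG a b d) p‖ ^ 2
      ≤ (2 * ∑ m, |‖p (b m) - p (a m)‖ ^ 2 - d m ^ 2| * ‖p (b m) - p (a m)‖) ^ 2 := by
        gcongr
        exact norm_gradient_psiG_le a b d p
    _ ≤ 4 * ((∑ m, |‖p (b m) - p (a m)‖ ^ 2 - d m ^ 2| ^ 2) *
          ∑ m, ‖p (b m) - p (a m)‖ ^ 2) := by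
        rw [mul_pow]
        norm_num only
        gcongr
        exact Finset.sum_mul_sq_le_sq_mul_sq _ _ _
    _ ≤ 4 * ((4 * psiG a b d p) * ∑ m, (d m ^ 2 + 4 * r + 1)) := by
        simp only [sq_abs, hsum]
        gcongr with m _
        exact norm_sub_sq_le_of_psiG_le hp m
    _ ≤ _ := by linarith
end
end

section
/- Let A : [0,∞) → ℝ be a bounded C² function with A(0) = 0 and A'(y) > 0 for every y ≥ 0. Define h₁(y) = h₂(y) = 0 for y ≤ 0 and h₁(y) = A(y)·sin(log y), h₂(y) = A(y)·cos(log y) for y > 0. Then h₁ and h₂ satisfy properties (Pi)–(Pvi), and for every y > 0 one has [h₁,h₂](y) = h₂'(y)h₁(y) − h₁'(y)h₂(y) = −A(y)²/y. -/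
open Set

section LogOscillation

/-- The one-sided derivative of a function on `[0, ∞)` is a genuine derivative away from `0`. -/
lemma hasDerivAt_derivWithin_Ici {f : ℝ → ℝ} (hf : DifferentiableOn ℝ f (Ici 0)) {y : ℝ}
    (hy : 0 < y) : HasDerivAt f (derivWithin f (Ici 0) y) y :=
  (hf y hy.le).hasDerivWithinAt.hasDerivAt (Ici_mem_nhds hy)

/-- The derivative on `[0, ∞)` of a `C²` function is `C¹`. -/
lemma contDiffOn_one_derivWithin_Ici {A : ℝ → ℝ} (hA : ContDiffOn ℝ 2 A (Ici 0)) :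
    ContDiffOn ℝ 1 (derivWithin A (Ici 0)) (Ici 0) :=
  hA.derivWithin (uniqueDiffOn_Ici 0) (by norm_num)

/-- A `C²` function on `[0, ∞)` vanishing at `0` with positive derivative is comparable to the
identity near `0`, and its first two derivatives are bounded there. -/
lemma exists_bounds_near_zero {A : ℝ → ℝ} (hA : ContDiffOn ℝ 2 A (Ici 0)) (hA0 : A 0 = 0)
    (hA' : ∀ y ≥ (0 : ℝ), 0 < derivWithin A (Ici 0) y) :
    ∃ m > (0 : ℝ), ∃ M : ℝ, ∀ y ∈ Ioc (0 : ℝ) 1, m * y ≤ A y ∧ |A y| ≤ M * y ∧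
      |derivWithin A (Ici 0) y| ≤ M ∧ |derivWithin (derivWithin A (Ici 0)) (Ici 0) y| ≤ M := by
  have hB := contDiffOn_one_derivWithin_Ici hA
  have hD : ContinuousOn (derivWithin (derivWithin A (Ici 0)) (Ici 0)) (Ici 0) :=
    hB.continuousOn_derivWithin (uniqueDiffOn_Ici 0) le_rfl
  have hsub : Icc (0 : ℝ) 1 ⊆ Ici 0 := Icc_subset_Ici_self
  obtain ⟨M, hM⟩ := isCompact_Icc.exists_bound_of_continuousOn (hB.continuousOn.mono hsub)
  obtain ⟨N, hN⟩ := isCompact_Icc.exists_bound_of_continuousOn (hD.mono hsub)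
  obtain ⟨x₀, hx₀, hmin⟩ := isCompact_Icc.exists_isMinOn (nonempty_Icc.2 zero_le_one)
    (hB.continuousOn.mono hsub)
  refine ⟨_, hA' x₀ hx₀.1, max M N, fun y hy => ?_⟩
  have hyI : y ∈ Icc (0 : ℝ) 1 := Ioc_subset_Icc_self hy
  obtain ⟨ξ, hξ, hξA⟩ := exists_hasDerivAt_eq_slope A (derivWithin A (Ici 0)) hy.1
    (hA.continuousOn.mono Icc_subset_Ici_self)
    (fun x hx => hasDerivAt_derivWithin_Ici (hA.differentiableOn (by norm_num)) hx.1)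
  have hξI : ξ ∈ Icc (0 : ℝ) 1 := ⟨hξ.1.le, hξ.2.le.trans hy.2⟩
  have hAy : A y = derivWithin A (Ici 0) ξ * y := by
    rw [hξA, hA0, sub_zero, sub_zero, div_mul_cancel₀ _ hy.1.ne']
  refine ⟨?_, ?_, (hM y hyI).trans (le_max_left _ _), (hN y hyI).trans (le_max_right _ _)⟩
  · rw [hAy]
    exact mul_le_mul_of_nonneg_right (hmin hξI) hy.1.le
  · rw [hAy, abs_mul, abs_of_pos hy.1]
    exact mul_le_mul_of_nonneg_right ((hM ξ hξI).trans (le_max_left _ _)) hy.1.le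

variable {A B D s c h : ℝ → ℝ}

/-- The derivative of `A(y) s(log y)`, where `s' = c`. -/
lemma hasDerivAt_mul_comp_log (hA : ∀ y > (0 : ℝ), HasDerivAt A (B y) y)
    (hs : ∀ x, HasDerivAt s (c x) x) (hh : ∀ y > (0 : ℝ), h y = A y * s (Real.log y))
    {y : ℝ} (hy : 0 < y) :
    HasDerivAt h (B y * s (Real.log y) + A y * (c (Real.log y) * y⁻¹)) y := by
  have hlog := (hs (Real.log y)).comp y (Real.hasDerivAt_log hy.ne')
  refine ((hA y hy).mul hlog).congr_of_eventuallyEq ?_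
  filter_upwards [Ioi_mem_nhds hy] with z hz using hh z hz

/-- The second derivative of `A(y) s(log y)`, where `s' = c` and `c' = -s`. -/
lemma hasDerivAt_deriv_mul_comp_log (hA : ∀ y > (0 : ℝ), HasDerivAt A (B y) y)
    (hB : ∀ y > (0 : ℝ), HasDerivAt B (D y) y)
    (hs : ∀ x, HasDerivAt s (c x) x) (hc : ∀ x, HasDerivAt c (-s x) x)
    (hh : ∀ y > (0 : ℝ), h y = A y * s (Real.log y)) {y : ℝ} (hy : 0 < y) :
    HasDerivAt (deriv h) (D y * s (Real.log y) + 2 * (B y * c (Real.log y) * y⁻¹)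
      - A y * y⁻¹ * (s (Real.log y) + c (Real.log y)) * y⁻¹) y := by
  have hlog := Real.hasDerivAt_log hy.ne'
  have h₁ := (hB y hy).mul ((hs (Real.log y)).comp y hlog)
  have h₂ := (hA y hy).mul (((hc (Real.log y)).comp y hlog).mul (hasDerivAt_inv hy.ne'))
  have h₃ := (h₁.add h₂).congr_of_eventuallyEq (f₁ := deriv h) (by
    filter_upwards [Ioi_mem_nhds hy] with z hz
    exact (hasDerivAt_mul_comp_log hA hs hh hz).deriv)
  refine h₃.congr_deriv ?_
  simp only [Pi.mul_apply, Function.comp_apply]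
  field_simp
  ring

lemma abs_mul_le_of_abs_le_one {a b M : ℝ} (ha : |a| ≤ M) (hb : |b| ≤ 1) : |a * b| ≤ M := by
  rw [abs_mul]
  exact (mul_le_of_le_one_right (abs_nonneg a) hb).trans ha

/-- Bounds near `0` for `A(y) s(log y) / y` and for the first two derivatives of
`A(y) s(log y)`. -/
lemma abs_bounds_mul_comp_log (hA : ∀ y > (0 : ℝ), HasDerivAt A (B y) y)
    (hB : ∀ y > (0 : ℝ), HasDerivAt B (D y) y)
    (hs : ∀ x, HasDerivAt s (c x) x) (hc : ∀ x, HasDerivAt c (-s x) x)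
    (hs1 : ∀ x, |s x| ≤ 1) (hc1 : ∀ x, |c x| ≤ 1)
    (hh : ∀ y > (0 : ℝ), h y = A y * s (Real.log y)) {M y : ℝ} (hy : y ∈ Ioc (0 : ℝ) 1)
    (hAM : |A y| ≤ M * y) (hBM : |B y| ≤ M) (hDM : |D y| ≤ M) :
    |h y / y| ≤ M ∧ |deriv h y| ≤ 2 * M ∧ |deriv (deriv h) y * y| ≤ 5 * M := by
  have hy0 := hy.1
  have hAy : |A y * y⁻¹| ≤ M := by
    rw [← div_eq_mul_inv, abs_div, abs_of_pos hy0]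
    exact (div_le_iff₀ hy0).2 hAM
  have hAs := abs_mul_le_of_abs_le_one hAy (hs1 (Real.log y))
  have hAc := abs_mul_le_of_abs_le_one hAy (hc1 (Real.log y))
  have hBs := abs_mul_le_of_abs_le_one hBM (hs1 (Real.log y))
  have hBc := abs_mul_le_of_abs_le_one hBM (hc1 (Real.log y))
  have hDs := abs_mul_le_of_abs_le_one (abs_mul_le_of_abs_le_one hDM (hs1 (Real.log y)))
    (abs_le.2 ⟨by linarith, hy.2⟩)
  refine ⟨?_, ?_, ?_⟩
  · rw [hh y hy0]
    convert hAs using 2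
    ring
  · rw [(hasDerivAt_mul_comp_log hA hs hh hy0).deriv, abs_le]
    rw [abs_le] at hBs hAc
    constructor <;> linarith
  · rw [(hasDerivAt_deriv_mul_comp_log hA hB hs hc hh hy0).deriv]
    have : (D y * s (Real.log y) + 2 * (B y * c (Real.log y) * y⁻¹)
        - A y * y⁻¹ * (s (Real.log y) + c (Real.log y)) * y⁻¹) * y =
        D y * s (Real.log y) * y + 2 * (B y * c (Real.log y))
        - A y * y⁻¹ * s (Real.log y) - A y * y⁻¹ * c (Real.log y) := by
      field_simp
      ring
    rw [this, abs_le]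
    rw [abs_le] at hDs hBc hAs hAc
    constructor <;> linarith

lemma contDiffOn_mul_comp_log (hA : ContDiffOn ℝ 2 A (Ici 0)) (hs : ContDiff ℝ 2 s)
    (hh : ∀ y > (0 : ℝ), h y = A y * s (Real.log y)) : ContDiffOn ℝ 2 h (Ioi 0) := by
  refine ContDiffOn.congr ((hA.mono Ioi_subset_Ici_self).mul (hs.comp_contDiffOn ?_)) hh
  exact Real.contDiffOn_log.mono fun y hy => ne_of_gt hy

end LogOscillation

/-- Let `A : [0,∞) → ℝ` be a bounded `C²` function with `A(0) = 0` and
`A'(y) > 0` for every `y ≥ 0`. Define `h₁(y) = h₂(y) = 0` for `y ≤ 0` and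
`h₁(y) = A(y)·sin(log y)`, `h₂(y) = A(y)·cos(log y)` for `y > 0`. Then `h₁` and `h₂` satisfy
properties (Pi)–(Pvi), and for every `y > 0` one has
`[h₁,h₂](y) = h₂'(y)h₁(y) − h₁'(y)h₂(y) = −A(y)²/y`. -/
theorem stmt_9 (A : ℝ → ℝ)
    (hA_smooth : ContDiffOn ℝ 2 A (Ici 0))
    (hA_bdd : ∃ C : ℝ, ∀ y ≥ (0 : ℝ), |A y| ≤ C)
    (hA0 : A 0 = 0)
    (hA' : ∀ y ≥ (0 : ℝ), 0 < derivWithin A (Ici 0) y)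
    (h₁ h₂ : ℝ → ℝ)
    (hh₁_neg : ∀ y ≤ (0 : ℝ), h₁ y = 0) (hh₂_neg : ∀ y ≤ (0 : ℝ), h₂ y = 0)
    (hh₁_pos : ∀ y > (0 : ℝ), h₁ y = A y * Real.sin (Real.log y))
    (hh₂_pos : ∀ y > (0 : ℝ), h₂ y = A y * Real.cos (Real.log y)) :
    -- (Pi): h_ν vanishes on (−∞, 0]
    ((∀ y ≤ (0 : ℝ), h₁ y = 0 ∧ h₂ y = 0) ∧
    -- (Pii): h_ν is bounded and of class C² on (0,∞)
    (∃ C : ℝ, ∀ y > (0 : ℝ), |h₁ y| ≤ C ∧ |h₂ y| ≤ C) ∧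
    ContDiffOn ℝ 2 h₁ (Ioi 0) ∧ ContDiffOn ℝ 2 h₂ (Ioi 0) ∧
    -- (Piii): h_ν(y)/y remains bounded as y ↓ 0
    (∃ C : ℝ, ∃ δ > (0 : ℝ), ∀ y ∈ Ioc (0 : ℝ) δ, |h₁ y / y| ≤ C ∧ |h₂ y / y| ≤ C) ∧
    -- (Piv): h_ν'(y) remains bounded as y ↓ 0
    (∃ C : ℝ, ∃ δ > (0 : ℝ), ∀ y ∈ Ioc (0 : ℝ) δ, |deriv h₁ y| ≤ C ∧ |deriv h₂ y| ≤ C) ∧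
    -- (Pv): h_ν''(y)·y remains bounded as y ↓ 0
    (∃ C : ℝ, ∃ δ > (0 : ℝ), ∀ y ∈ Ioc (0 : ℝ) δ,
      |deriv (deriv h₁) y * y| ≤ C ∧ |deriv (deriv h₂) y * y| ≤ C) ∧
    -- (Pvi): [h₁,h₂](y) ≤ −c·y on some (0, r]
    (∃ r > (0 : ℝ), ∃ c > (0 : ℝ), ∀ y ∈ Ioc (0 : ℝ) r,
      deriv h₂ y * h₁ y - deriv h₁ y * h₂ y ≤ -c * y)) ∧
    -- the bracket formula [h₁,h₂](y) = −A(y)²/y for y > 0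
    (∀ y > (0 : ℝ), deriv h₂ y * h₁ y - deriv h₁ y * h₂ y = -(A y) ^ 2 / y) := by
  have hB := contDiffOn_one_derivWithin_Ici hA_smooth
  have dA : ∀ y > (0 : ℝ), HasDerivAt A (derivWithin A (Ici 0) y) y := fun y hy =>
    hasDerivAt_derivWithin_Ici (hA_smooth.differentiableOn (by norm_num)) hy
  have dB : ∀ y > (0 : ℝ), HasDerivAt (derivWithin A (Ici 0))
      (derivWithin (derivWithin A (Ici 0)) (Ici 0) y) y := fun y hy =>
    hasDerivAt_derivWithin_Ici (hB.differentiableOn (by norm_num)) hy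
  have dnegsin : ∀ x, HasDerivAt (fun x => -Real.sin x) (-Real.cos x) x := fun x =>
    (Real.hasDerivAt_sin x).neg
  have bnegsin : ∀ x, |(fun x => -Real.sin x) x| ≤ 1 := fun x => by
    simpa only [abs_neg] using Real.abs_sin_le_one x
  obtain ⟨m, hm, M, hmM⟩ := exists_bounds_near_zero hA_smooth hA0 hA'
  have bound₁ := fun y (hy : y ∈ Ioc (0 : ℝ) 1) =>
    abs_bounds_mul_comp_log dA dB Real.hasDerivAt_sin Real.hasDerivAt_cos Real.abs_sin_le_one
      Real.abs_cos_le_one hh₁_pos hy (hmM y hy).2.1 (hmM y hy).2.2.1 (hmM y hy).2.2.2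
  have bound₂ := fun y (hy : y ∈ Ioc (0 : ℝ) 1) =>
    abs_bounds_mul_comp_log dA dB Real.hasDerivAt_cos dnegsin Real.abs_cos_le_one
      bnegsin hh₂_pos hy (hmM y hy).2.1 (hmM y hy).2.2.1 (hmM y hy).2.2.2
  have bracket : ∀ y > (0 : ℝ),
      deriv h₂ y * h₁ y - deriv h₁ y * h₂ y = -(A y) ^ 2 / y := fun y hy => by
    rw [(hasDerivAt_mul_comp_log dA Real.hasDerivAt_sin hh₁_pos hy).deriv,
      (hasDerivAt_mul_comp_log dA Real.hasDerivAt_cos hh₂_pos hy).deriv, hh₁_pos y hy,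
      hh₂_pos y hy]
    linear_combination (-(A y) ^ 2 / y) * Real.sin_sq_add_cos_sq (Real.log y)
  refine ⟨⟨fun y hy => ⟨hh₁_neg y hy, hh₂_neg y hy⟩, ?_,
    contDiffOn_mul_comp_log hA_smooth Real.contDiff_sin hh₁_pos,
    contDiffOn_mul_comp_log hA_smooth Real.contDiff_cos hh₂_pos,
    ⟨M, 1, one_pos, fun y hy => ⟨(bound₁ y hy).1, (bound₂ y hy).1⟩⟩,
    ⟨2 * M, 1, one_pos, fun y hy => ⟨(bound₁ y hy).2.1, (bound₂ y hy).2.1⟩⟩,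
    ⟨5 * M, 1, one_pos, fun y hy => ⟨(bound₁ y hy).2.2, (bound₂ y hy).2.2⟩⟩,
    ⟨1, one_pos, m ^ 2, by positivity, fun y hy => ?_⟩⟩, bracket⟩
  · obtain ⟨C, hC⟩ := hA_bdd
    refine ⟨C, fun y hy => ⟨?_, ?_⟩⟩
    · rw [hh₁_pos y hy]
      exact abs_mul_le_of_abs_le_one (hC y hy.le) (Real.abs_sin_le_one _)
    · rw [hh₂_pos y hy]
      exact abs_mul_le_of_abs_le_one (hC y hy.le) (Real.abs_cos_le_one _)
  · have hsq : (m * y) ^ 2 ≤ (A y) ^ 2 :=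
      pow_le_pow_left₀ (mul_nonneg hm.le hy.1.le) (hmM y hy).1 2
    rw [bracket y hy.1, div_le_iff₀ hy.1]
    linarith
end

section
/- Consider the control-affine system ṗ = Σ_{k=1}^μ u_k·B_k(p) on ℝⁿ with smooth vector fields B₁,…,B_μ and nonnegative smooth output function ψ : ℝⁿ → ℝ, under the output-feedback law u_k = u_{(k,1)}(t)·h₁(ψ(p)) + u_{(k,2)}(t)·h₂(ψ(p)). Assume there exists p* ∈ ℝⁿ such that: (i) ψ(p*) = 0 is a strict local minimum of ψ and D²ψ(p*) is positive definite; (ii) there is a neighborhood W of p* such that for every p ∈ W the vectors B₁(p),…,B_μ(p) span ℝⁿ. Then there exist constants c, r > 0 such that for every t₀ ∈ ℝ and every p₀ in the connected component of {p : ψ(p) ≤ r} containing p*, the maximal solution γ of the closed-loop system with γ(t₀) = p₀ exists on [t₀,∞), γ(t) converges to p* as t → ∞, and ψ(γ(t)) ≤ 2ψ(p₀)/(1 + c·ψ(p₀)·(t − t₀)) for every t ≥ t₀. -/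
open Set

noncomputable section

/-- Properties (Pi)–(Pvi) of the pair of functions `h₁, h₂ : ℝ → ℝ`. -/
def GoodPair (h₁ h₂ : ℝ → ℝ) : Prop :=
  -- (Pi)
  (∀ y ≤ (0 : ℝ), h₁ y = 0) ∧ (∀ y ≤ (0 : ℝ), h₂ y = 0) ∧
  -- (Pii)
  (∃ C : ℝ, ∀ y > (0 : ℝ), |h₁ y| ≤ C ∧ |h₂ y| ≤ C) ∧
  ContDiffOn ℝ 2 h₁ (Ioi 0) ∧ ContDiffOn ℝ 2 h₂ (Ioi 0) ∧
  -- (Piii)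
  (∃ C : ℝ, ∃ δ > (0 : ℝ), ∀ y ∈ Ioc (0 : ℝ) δ, |h₁ y / y| ≤ C ∧ |h₂ y / y| ≤ C) ∧
  -- (Piv)
  (∃ C : ℝ, ∃ δ > (0 : ℝ), ∀ y ∈ Ioc (0 : ℝ) δ, |deriv h₁ y| ≤ C ∧ |deriv h₂ y| ≤ C) ∧
  -- (Pv)
  (∃ C : ℝ, ∃ δ > (0 : ℝ), ∀ y ∈ Ioc (0 : ℝ) δ,
    |deriv (deriv h₁) y * y| ≤ C ∧ |deriv (deriv h₂) y * y| ≤ C) ∧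
  -- (Pvi)
  (∃ r > (0 : ℝ), ∃ c > (0 : ℝ), ∀ y ∈ Ioc (0 : ℝ) r,
    deriv h₂ y * h₁ y - deriv h₁ y * h₂ y ≤ -c * y)

/-- The right-hand side of the closed-loop system
`ṗ = Σ_{k=1}^μ (u_{(k,1)}(t)·h₁(ψ(p)) + u_{(k,2)}(t)·h₂(ψ(p)))·B_k(p)` with
`u_{(k,1)}(t) = √ω_k·cos(ω_k t + φ_k)` and `u_{(k,2)}(t) = √ω_k·sin(ω_k t + φ_k)`. -/
def clLoop {n μ : ℕ} (B : Fin μ → EuclideanSpace ℝ (Fin n) → EuclideanSpace ℝ (Fin n))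
    (ψ : EuclideanSpace ℝ (Fin n) → ℝ) (h₁ h₂ : ℝ → ℝ) (ω φv : Fin μ → ℝ)
    (t : ℝ) (p : EuclideanSpace ℝ (Fin n)) : EuclideanSpace ℝ (Fin n) :=
  ∑ k : Fin μ,
    (Real.sqrt (ω k) * Real.cos (ω k * t + φv k) * h₁ (ψ p) +
     Real.sqrt (ω k) * Real.sin (ω k * t + φv k) * h₂ (ψ p)) • B k p

open Filter Topology Metric Asymptotics
open scoped NNReal

/-- A bounded time-dependent vector field which is Lipschitz in space and continuous in time has
a global solution through every initial point. -/
theorem exists_global_solution_of_lipschitz_of_bounded {E : Type*} [NormedAddCommGroup E]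
    [NormedSpace ℝ E] [CompleteSpace E] {F : ℝ → E → E} {K L : ℝ≥0}
    (hK : ∀ t, LipschitzWith K (F t)) (hc : ∀ x, Continuous fun t => F t x)
    (hL : ∀ t x, ‖F t x‖ ≤ L) (t₀ : ℝ) (x₀ : E) :
    ∃ γ : ℝ → E, γ t₀ = x₀ ∧ ∀ t, HasDerivAt γ (F t (γ t)) t := by
  have hloc : ∀ N : ℕ, ∃ α : ℝ → E, α t₀ = x₀ ∧
      ∀ t ∈ Ioo (t₀ - (N + 1)) (t₀ + (N + 1)), HasDerivAt α (F t (α t)) t := by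
    intro N
    have hmem : t₀ ∈ Icc (t₀ - (N + 1 : ℝ)) (t₀ + (N + 1)) := by
      constructor <;> linarith [(Nat.cast_nonneg N : (0 : ℝ) ≤ N)]
    have hPL : IsPicardLindelof F (tmin := t₀ - (N + 1 : ℝ)) (tmax := t₀ + (N + 1))
        ⟨t₀, hmem⟩ x₀ (L * (N + 1)) 0 L K :=
      { lipschitzOnWith := fun t _ => (hK t).lipschitzOnWith
        continuousOn := fun x _ => (hc x).continuousOn
        norm_le := fun t _ x _ => hL t x
        mul_max_le := by simp }
    obtain ⟨α, h0, hα⟩ := hPL.exists_eq_forall_mem_Icc_hasDerivWithinAt₀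
    exact ⟨α, h0, fun t ht =>
      (hα t (Ioo_subset_Icc_self ht)).hasDerivAt (Icc_mem_nhds ht.1 ht.2)⟩
  choose α h0 hα using hloc
  have hmono : ∀ N M : ℕ, N ≤ M → EqOn (α N) (α M) (Ioo (t₀ - (N + 1)) (t₀ + (N + 1))) := by
    intro N M hNM
    have hNM' : (N : ℝ) ≤ M := by exact_mod_cast hNM
    refine ODE_solution_unique_of_mem_Ioo (v := F) (s := fun _ => univ) (K := K) (t₀ := t₀)
      (fun t _ => (hK t).lipschitzOnWith) ?_ (fun t ht => ⟨hα N t ht, trivial⟩)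
      (fun t ht => ⟨hα M t ⟨by linarith [ht.1], by linarith [ht.2]⟩, trivial⟩)
      ((h0 N).trans (h0 M).symm)
    constructor <;> linarith [(Nat.cast_nonneg N : (0 : ℝ) ≤ N)]
  have hagree : ∀ N M : ℕ, ∀ t, |t - t₀| < N + 1 → |t - t₀| < M + 1 → α N t = α M t := by
    intro N M t hN hM
    rw [abs_lt] at hN hM
    rcases le_total N M with h | h
    · exact hmono N M h ⟨by linarith, by linarith⟩
    · exact (hmono M N h ⟨by linarith, by linarith⟩).symm
  have hlt : ∀ t, |t - t₀| < ⌈|t - t₀|⌉₊ + 1 := fun t =>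
    (Nat.le_ceil _).trans_lt (lt_add_one _)
  refine ⟨fun t => α ⌈|t - t₀|⌉₊ t, h0 _, fun t => ?_⟩
  have hd := hα ⌈|t - t₀|⌉₊ t (by
    have := abs_lt.1 (hlt t)
    constructor <;> linarith)
  refine hd.congr_of_eventuallyEq ?_
  have hopen : ∀ᶠ s in 𝓝 t, |s - t₀| < ⌈|t - t₀|⌉₊ + 1 :=
    (by fun_prop : Continuous fun s : ℝ => |s - t₀|).continuousAt.eventually_lt
      continuousAt_const (hlt t)
  filter_upwards [hopen] with s hs
  exact hagree _ _ s (hlt s) hs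

theorem eventually_eventuallyEq_nhds_of_punctured {X Y : Type*} [TopologicalSpace X] [T1Space X]
    {p₀ : X} {f g : X → Y} (h : f =ᶠ[𝓝[≠] p₀] g) :
    ∀ᶠ p in 𝓝[≠] p₀, f =ᶠ[𝓝 p] g := by
  have h' := eventually_eventually_nhdsWithin.2 h
  filter_upwards [h', self_mem_nhdsWithin] with p hp hne
  rw [isOpen_compl_singleton.nhdsWithin_eq hne] at hp
  exact hp

theorem isBigO_comp_sqrt_zpow {X : Type*} [TopologicalSpace X] {p₀ : X} {ψ : X → ℝ}
    {h : ℝ → ℝ} {d : ℤ} (hψ : ∀ᶠ p in 𝓝[≠] p₀, 0 < ψ p)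
    (hψ0 : Tendsto ψ (𝓝[≠] p₀) (𝓝 0)) (hO : h =O[𝓝[>] 0] fun y => y ^ d) :
    (fun p => h (ψ p)) =O[𝓝[≠] p₀] fun p => √(ψ p) ^ (2 * d) := by
  have ht : Tendsto ψ (𝓝[≠] p₀) (𝓝[>] 0) := tendsto_nhdsWithin_iff.2 ⟨hψ0, hψ⟩
  refine (hO.comp_tendsto ht).congr' EventuallyEq.rfl ?_
  filter_upwards [hψ] with p hp
  rw [zpow_mul, show √(ψ p) ^ (2 : ℤ) = ψ p from Real.sq_sqrt hp.le]
  rfl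

section SmoothSymbols

open scoped ContDiff

/-- `HomSymbol B σ p₀ N d f` means that near `p₀` (but away from it) the function `f`, together
with its iterated derivatives of order at most `N` along the vector fields `B j`, behaves like a
function that is homogeneous of degree `d` with respect to the gauge `σ`. -/
def HomSymbol {ι E : Type*} [NormedAddCommGroup E] [NormedSpace ℝ E] (B : ι → E → E)
    (σ : E → ℝ) (p₀ : E) : ℕ → ℤ → (E → ℝ) → Prop
  | 0, d, f => f =O[𝓝[≠] p₀] fun p => σ p ^ d
  | N + 1, d, f => f =O[𝓝[≠] p₀] (fun p => σ p ^ d) ∧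
      (∀ᶠ p in 𝓝[≠] p₀, DifferentiableAt ℝ f p) ∧
      ∀ j, HomSymbol B σ p₀ N (d - 1) fun p => fderiv ℝ f p (B j p)

namespace HomSymbol

variable {ι E : Type*} [NormedAddCommGroup E] [NormedSpace ℝ E] {B : ι → E → E}
  {σ : E → ℝ} {p₀ : E} {N : ℕ} {d e : ℤ} {f g : E → ℝ}

theorem isBigO (hf : HomSymbol B σ p₀ N d f) : f =O[𝓝[≠] p₀] fun p => σ p ^ d := by
  cases N with
  | zero => exact hf
  | succ N => exact hf.1

theorem differentiableAt (hf : HomSymbol B σ p₀ (N + 1) d f) :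
    ∀ᶠ p in 𝓝[≠] p₀, DifferentiableAt ℝ f p := hf.2.1

theorem fderiv_apply (hf : HomSymbol B σ p₀ (N + 1) d f) (j : ι) :
    HomSymbol B σ p₀ N (d - 1) fun p => fderiv ℝ f p (B j p) := hf.2.2 j

theorem of_succ (hf : HomSymbol B σ p₀ (N + 1) d f) : HomSymbol B σ p₀ N d f := by
  induction N generalizing d f with
  | zero => exact hf.1
  | succ N ih => exact ⟨hf.1, hf.2.1, fun j => ih (hf.2.2 j)⟩

theorem congr (hf : HomSymbol B σ p₀ N d f) (h : f =ᶠ[𝓝[≠] p₀] g) :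
    HomSymbol B σ p₀ N d g := by
  induction N generalizing d f g with
  | zero => exact IsBigO.congr' hf h EventuallyEq.rfl
  | succ N ih =>
    have h' := eventually_eventuallyEq_nhds_of_punctured h
    refine ⟨hf.1.congr' h EventuallyEq.rfl, ?_, fun j => ih (hf.2.2 j) ?_⟩
    · filter_upwards [h', hf.2.1] with p hp hd
      exact hd.congr_of_eventuallyEq hp.symm
    · filter_upwards [h'] with p hp
      rw [hp.fderiv_eq]

theorem add (hf : HomSymbol B σ p₀ N d f) (hg : HomSymbol B σ p₀ N d g) :
    HomSymbol B σ p₀ N d fun p => f p + g p := by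
  induction N generalizing d f g with
  | zero => exact IsBigO.add hf hg
  | succ N ih =>
    refine ⟨hf.1.add hg.1, ?_, fun j => (ih (hf.2.2 j) (hg.2.2 j)).congr ?_⟩
    · filter_upwards [hf.2.1, hg.2.1] with p h1 h2 using h1.add h2
    · filter_upwards [hf.2.1, hg.2.1] with p h1 h2
      rw [fderiv_fun_add h1 h2]
      rfl

theorem neg (hf : HomSymbol B σ p₀ N d f) : HomSymbol B σ p₀ N d fun p => -f p := by
  induction N generalizing d f with
  | zero => exact IsBigO.neg_left hf
  | succ N ih =>
    refine ⟨hf.1.neg_left, ?_, fun j => (ih (hf.2.2 j)).congr ?_⟩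
    · filter_upwards [hf.2.1] with p h1 using h1.neg
    · filter_upwards with p
      rw [fderiv_fun_neg]
      rfl

theorem mul (hσ : ∀ᶠ p in 𝓝[≠] p₀, 0 < σ p) (hf : HomSymbol B σ p₀ N d f)
    (hg : HomSymbol B σ p₀ N e g) : HomSymbol B σ p₀ N (d + e) fun p => f p * g p := by
  have hz : ∀ {f g : E → ℝ} {d e : ℤ}, f =O[𝓝[≠] p₀] (fun p => σ p ^ d) →
      g =O[𝓝[≠] p₀] (fun p => σ p ^ e) →
      (fun p => f p * g p) =O[𝓝[≠] p₀] fun p => σ p ^ (d + e) := by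
    intro f g d e h1 h2
    refine (h1.mul h2).congr' EventuallyEq.rfl ?_
    filter_upwards [hσ] with p hp using (zpow_add₀ hp.ne' d e).symm
  induction N generalizing d e f g with
  | zero => exact hz hf hg
  | succ N ih =>
    refine ⟨hz hf.1 hg.1, ?_, fun j => ?_⟩
    · filter_upwards [hf.2.1, hg.2.1] with p h1 h2 using h1.mul h2
    · have h1 := ih hf.of_succ (hg.2.2 j)
      have h2 := ih (hf.2.2 j) hg.of_succ
      rw [show d + (e - 1) = d + e - 1 by ring] at h1
      rw [show d - 1 + e = d + e - 1 by ring] at h2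
      refine (h1.add h2).congr ?_
      filter_upwards [hf.2.1, hg.2.1] with p h1 h2
      rw [fderiv_fun_mul h1 h2]
      simp [mul_comm]

theorem mono_degree (hσ : ∀ᶠ p in 𝓝[≠] p₀, 0 < σ p) (hσ1 : ∀ᶠ p in 𝓝[≠] p₀, σ p ≤ 1)
    (hde : e ≤ d) (hf : HomSymbol B σ p₀ N d f) : HomSymbol B σ p₀ N e f := by
  have hz : ∀ {d e : ℤ}, e ≤ d → (fun p => σ p ^ d) =O[𝓝[≠] p₀] fun p => σ p ^ e := by
    intro d e hde
    refine IsBigO.of_bound 1 ?_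
    filter_upwards [hσ, hσ1] with p h0 h1
    rw [Real.norm_of_nonneg (zpow_nonneg h0.le _), Real.norm_of_nonneg (zpow_nonneg h0.le _),
      one_mul]
    exact zpow_le_zpow_right_of_le_one₀ h0 h1 hde
  induction N generalizing d e f with
  | zero => exact IsBigO.trans hf (hz hde)
  | succ N ih => exact ⟨hf.1.trans (hz hde), hf.2.1, fun j => ih (by lia) (hf.2.2 j)⟩

theorem of_contDiff (hB : ∀ j, ContDiff ℝ ∞ (B j)) (hσ : ∀ᶠ p in 𝓝[≠] p₀, 0 < σ p)
    (hσ1 : ∀ᶠ p in 𝓝[≠] p₀, σ p ≤ 1) (hf : ContDiff ℝ ∞ f) : HomSymbol B σ p₀ N 0 f := by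
  have hz : f =O[𝓝[≠] p₀] fun p => σ p ^ (0 : ℤ) := by
    simp only [zpow_zero]
    exact (hf.continuous.continuousAt.isBigO_one ℝ).mono nhdsWithin_le_nhds
  induction N generalizing f with
  | zero => exact hz
  | succ N ih =>
    refine ⟨hz, Eventually.of_forall fun p => hf.differentiable (by simp) p, fun j => ?_⟩
    have hs : ContDiff ℝ ∞ fun p => fderiv ℝ f p (B j p) :=
      (hf.fderiv_right (by simp)).clm_apply (hB j)
    refine mono_degree hσ hσ1 (by norm_num) (ih hs ?_)
    simp only [zpow_zero]
    exact (hs.continuous.continuousAt.isBigO_one ℝ).mono nhdsWithin_le_nhds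

theorem inv_of_sqrt {ψ : E → ℝ} (hψ : ∀ᶠ p in 𝓝[≠] p₀, 0 < ψ p)
    (h : HomSymbol B (fun p => √(ψ p)) p₀ N 2 ψ) :
    HomSymbol B (fun p => √(ψ p)) p₀ N (-2) fun p => (ψ p)⁻¹ := by
  have hσ : ∀ᶠ p in 𝓝[≠] p₀, 0 < √(ψ p) := hψ.mono fun p hp => Real.sqrt_pos.2 hp
  have hz : (fun p => (ψ p)⁻¹) =O[𝓝[≠] p₀] fun p => √(ψ p) ^ (-2 : ℤ) := by
    refine EventuallyEq.isBigO ?_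
    filter_upwards [hψ] with p hp
    rw [zpow_neg]
    congr 1
    exact (Real.sq_sqrt hp.le).symm
  induction N with
  | zero => exact hz
  | succ N ih =>
    have hi := ih h.of_succ
    refine ⟨hz, ?_, fun j => ?_⟩
    · filter_upwards [hψ, h.2.1] with p hp hd using hd.inv hp.ne'
    · have := ((hi.mul hσ hi).mul hσ (h.2.2 j)).neg
      refine HomSymbol.congr (d := -2 - 1) (by simpa using this) ?_
      filter_upwards [hψ, h.2.1] with p hp hd
      have h' := (hasDerivAt_inv hp.ne').comp_hasFDerivAt p hd.hasFDerivAt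
      rw [HasFDerivAt.fderiv (f := fun p => (ψ p)⁻¹) h']
      simp [pow_two]

theorem comp_succ {ψ : E → ℝ} {h : ℝ → ℝ} (hψ : ∀ᶠ p in 𝓝[≠] p₀, 0 < ψ p)
    (hψ0 : Tendsto ψ (𝓝[≠] p₀) (𝓝 0)) (hh : DifferentiableOn ℝ h (Ioi 0))
    (hO : h =O[𝓝[>] 0] fun y => y ^ d)
    (hs : HomSymbol B (fun p => √(ψ p)) p₀ (N + 1) 2 ψ)
    (h' : HomSymbol B (fun p => √(ψ p)) p₀ N (2 * d - 2) fun p => deriv h (ψ p)) :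
    HomSymbol B (fun p => √(ψ p)) p₀ (N + 1) (2 * d) fun p => h (ψ p) := by
  have hσ : ∀ᶠ p in 𝓝[≠] p₀, 0 < √(ψ p) := hψ.mono fun p hp => Real.sqrt_pos.2 hp
  have hd : ∀ᶠ p in 𝓝[≠] p₀, HasDerivAt h (deriv h (ψ p)) (ψ p) := hψ.mono fun p hp =>
    (hh.differentiableAt (Ioi_mem_nhds hp)).hasDerivAt
  refine ⟨isBigO_comp_sqrt_zpow hψ hψ0 hO, ?_, fun j => ?_⟩
  · filter_upwards [hd, hs.2.1] with p h1 h2 using h1.differentiableAt.comp p h2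
  · have := h'.mul hσ (hs.2.2 j)
    refine HomSymbol.congr (d := 2 * d - 1) (by convert! this using 1; ring) ?_
    filter_upwards [hd, hs.2.1] with p h1 h2
    rw [HasFDerivAt.fderiv (f := fun p => h (ψ p)) (h1.comp_hasFDerivAt p h2.hasFDerivAt)]
    simp

end HomSymbol

/-- Near a zero minimum, a smooth function is its Hessian quadratic form up to second order. -/
theorem isLittleO_sub_half_hessian {E : Type*} [NormedAddCommGroup E] [NormedSpace ℝ E]
    {ψ : E → ℝ} (hψ : ContDiff ℝ ∞ ψ) {p₀ : E} (h0 : ψ p₀ = 0) (h1 : fderiv ℝ ψ p₀ = 0) :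
    (fun p => ψ p - 1 / 2 * fderiv ℝ (fderiv ℝ ψ) p₀ (p - p₀) (p - p₀)) =o[𝓝 p₀]
      fun p => ‖p - p₀‖ ^ 2 := by
  set A := fderiv ℝ (fderiv ℝ ψ) p₀ with hA
  have hsymm : ∀ v w, A v w = A w v := fun v w =>
    (hψ.contDiffAt.isSymmSndFDerivAt (by
      simpa using WithTop.coe_le_coe.2 (le_top : (2 : ℕ∞) ≤ ⊤))) v w
  have hd : DifferentiableAt ℝ (fderiv ℝ ψ) p₀ :=
    (hψ.fderiv_right (m := ∞) (by simp)).differentiable (by simp) p₀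
  have hlin : (fun p => fderiv ℝ ψ p - A (p - p₀)) =o[𝓝 p₀] fun p => ‖p - p₀‖ ^ 1 := by
    have := hd.hasFDerivAt.isLittleO
    simpa [h1, ← hA] using this.norm_right
  have hder : ∀ p ∈ (univ : Set E), HasFDerivWithinAt
      (fun p => ψ p - 1 / 2 * A (p - p₀) (p - p₀)) (fderiv ℝ ψ p - A (p - p₀)) univ p := by
    intro p _
    rw [hasFDerivWithinAt_univ]
    have hx : HasFDerivAt (fun p : E => p - p₀) (ContinuousLinearMap.id ℝ E) p :=
      (hasFDerivAt_id p).sub_const p₀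
    have hq := ((A.hasFDerivAt.comp p hx).clm_apply hx).const_mul (1 / 2 : ℝ)
    have hp := ((hψ.differentiable (by simp) p).hasFDerivAt).sub hq
    refine hp.congr_fderiv ?_
    ext v
    have hs := hsymm v (p - p₀)
    simp only [map_sub, sub_apply] at hs
    simp
    linarith
  have := convex_univ.isLittleO_pow_succ (mem_univ p₀) hder (n := 1) (by simpa using hlin)
  simpa [h0] using this

theorem exists_pos_mul_sq_le_of_hessian_pos {E : Type*} [NormedAddCommGroup E]
    [NormedSpace ℝ E] [FiniteDimensional ℝ E] {ψ : E → ℝ} (hψ : ContDiff ℝ ∞ ψ) {p₀ : E}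
    (h0 : ψ p₀ = 0) (h1 : fderiv ℝ ψ p₀ = 0)
    (hpos : ∀ v, v ≠ 0 → 0 < fderiv ℝ (fderiv ℝ ψ) p₀ v v) :
    ∃ m > 0, ∀ᶠ p in 𝓝 p₀, m * ‖p - p₀‖ ^ 2 ≤ ψ p := by
  have hlo := isLittleO_sub_half_hessian hψ h0 h1
  set A := fderiv ℝ (fderiv ℝ ψ) p₀
  obtain ⟨a, ha, hle⟩ := (isCompact_sphere (0 : E) 1).exists_forall_le' (a := 0)
    (f := fun v => A v v) (by fun_prop) (fun v hv => hpos v (by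
      rintro rfl
      simp at hv))
  have hq : ∀ v, a * ‖v‖ ^ 2 ≤ A v v := by
    intro v
    rcases eq_or_ne v 0 with rfl | hv
    · simp
    have hn : 0 < ‖v‖ := norm_pos_iff.2 hv
    have := hle (‖v‖⁻¹ • v) (by simp [norm_smul, hn.ne'])
    simp only [map_smul, smul_apply, smul_eq_mul] at this
    field_simp at this
    linarith
  refine ⟨a / 4, by positivity, ?_⟩
  filter_upwards [hlo.def (c := a / 4) (by positivity)] with p hp
  rw [Real.norm_eq_abs, Real.norm_of_nonneg (by positivity)] at hp
  have := (abs_le.1 hp).1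
  linarith [hq (p - p₀)]

theorem isBigO_sq_of_fderiv_eq_zero {E : Type*} [NormedAddCommGroup E]
    [NormedSpace ℝ E] {ψ : E → ℝ} (hψ : ContDiff ℝ ∞ ψ) {p₀ : E}
    (h0 : ψ p₀ = 0) (h1 : fderiv ℝ ψ p₀ = 0) :
    ψ =O[𝓝 p₀] fun p => ‖p - p₀‖ ^ 2 := by
  have hlo := (isLittleO_sub_half_hessian hψ h0 h1).isBigO
  set A := fderiv ℝ (fderiv ℝ ψ) p₀
  have hq : (fun p => 1 / 2 * A (p - p₀) (p - p₀)) =O[𝓝 p₀] fun p => ‖p - p₀‖ ^ 2 := by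
    refine IsBigO.of_bound (1 / 2 * ‖A‖) (Eventually.of_forall fun p => ?_)
    rw [norm_mul, norm_pow, norm_norm, mul_assoc, pow_two, ← mul_assoc ‖A‖]
    simpa using A.le_opNorm₂ (p - p₀) (p - p₀)
  simpa using hlo.add hq

/-- If the vectors `B k p₀` span the space and the Hessian of `ψ` at its critical point `p₀` is
positive definite, then the derivatives of `ψ` along the fields `B k` control the distance to
`p₀`. -/
theorem exists_pos_mul_sq_le_sum_fderiv_sq {ι E : Type*} [Fintype ι] [NormedAddCommGroup E]
    [NormedSpace ℝ E] [FiniteDimensional ℝ E] {B : ι → E → E} (hB : ∀ k, ContDiff ℝ ∞ (B k))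
    {ψ : E → ℝ} (hψ : ContDiff ℝ ∞ ψ) {p₀ : E} (h1 : fderiv ℝ ψ p₀ = 0)
    (hpos : ∀ v, v ≠ 0 → 0 < fderiv ℝ (fderiv ℝ ψ) p₀ v v)
    (hspan : Submodule.span ℝ (range fun k => B k p₀) = ⊤) :
    ∃ m > 0, ∀ᶠ p in 𝓝 p₀, m * ‖p - p₀‖ ^ 2 ≤ ∑ k, (fderiv ℝ ψ p (B k p)) ^ 2 := by
  set A := fderiv ℝ (fderiv ℝ ψ) p₀ with hA
  have hd : DifferentiableAt ℝ (fderiv ℝ ψ) p₀ :=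
    (hψ.fderiv_right (m := ∞) (by simp)).differentiable (by simp) p₀
  have hder : HasFDerivAt (fun p k => fderiv ℝ ψ p (B k p))
      (ContinuousLinearMap.pi fun k => A.flip (B k p₀)) p₀ := by
    refine hasFDerivAt_pi.2 fun k => ?_
    have := hd.hasFDerivAt.clm_apply ((hB k).differentiable (by simp) p₀).hasFDerivAt
    refine this.congr_fderiv ?_
    ext v
    simp [h1, hA]
  set T := ContinuousLinearMap.pi fun k => A.flip (B k p₀) with hT
  have hker : LinearMap.ker (T : E →ₗ[ℝ] ι → ℝ) = ⊥ := by
    rw [LinearMap.ker_eq_bot']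
    intro v hv
    have hz : (A v : E →ₗ[ℝ] ℝ) = 0 := by
      refine LinearMap.ext_on_range hspan fun k => ?_
      simpa [hT] using congrFun hv k
    by_contra hne
    exact (hpos v hne).ne' (by simpa using LinearMap.congr_fun hz v)
  obtain ⟨K, hK, hanti⟩ := (T : E →ₗ[ℝ] ι → ℝ).exists_antilipschitzWith hker
  have hKpos : (0 : ℝ) < K := by exact_mod_cast hK
  refine ⟨(1 / (2 * K)) ^ 2, by positivity, ?_⟩
  filter_upwards [hder.isLittleO.def (c := 1 / (2 * K)) (by positivity)] with p hp
  have hT' : ‖p - p₀‖ ≤ K * ‖T (p - p₀)‖ := by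
    simpa using hanti.le_mul_dist (p - p₀) 0
  simp only [h1, zero_apply] at hp
  have htri : ‖T (p - p₀)‖ ≤ ‖fun k => fderiv ℝ ψ p (B k p)‖ + 1 / (2 * K) * ‖p - p₀‖ := by
    have := norm_sub_norm_le (T (p - p₀)) fun k => fderiv ℝ ψ p (B k p)
    rw [norm_sub_rev] at this
    have hp' : ‖(fun k => fderiv ℝ ψ p (B k p)) - T (p - p₀)‖ ≤ 1 / (2 * K) * ‖p - p₀‖ := by
      refine le_trans (le_of_eq ?_) hp
      congr 1
      ext k
      simp
    linarith
  have hlow : 1 / (2 * K) * ‖p - p₀‖ ≤ ‖fun k => fderiv ℝ ψ p (B k p)‖ := by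
    have h2 : 1 / (K : ℝ) * ‖p - p₀‖ ≤ ‖T (p - p₀)‖ := by
      rw [one_div, inv_mul_le_iff₀ hKpos]
      exact hT'
    have h3 : 1 / (K : ℝ) = 1 / (2 * K) + 1 / (2 * K) := by field_simp; norm_num
    rw [h3, add_mul] at h2
    linarith
  have hsq : ‖fun k => fderiv ℝ ψ p (B k p)‖ ≤ √(∑ k, (fderiv ℝ ψ p (B k p)) ^ 2) := by
    refine (pi_norm_le_iff_of_nonneg (Real.sqrt_nonneg _)).2 fun k => ?_
    rw [Real.norm_eq_abs]
    exact Real.abs_le_sqrt (Finset.single_le_sum (f := fun k => (fderiv ℝ ψ p (B k p)) ^ 2)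
      (fun i _ => sq_nonneg _) (Finset.mem_univ k))
  rw [← mul_pow]
  refine (pow_le_pow_left₀ (by positivity) (hlow.trans hsq) 2).trans (le_of_eq ?_)
  exact Real.sq_sqrt (Finset.sum_nonneg fun i _ => sq_nonneg _)

theorem exists_bounded_primitive_sin {a : ℝ} (ha : a ≠ 0) (b : ℝ) :
    ∃ W : ℝ → ℝ, (∀ t, HasDerivAt W (Real.sin (a * t + b)) t) ∧ ∃ C, ∀ t, |W t| ≤ C := by
  refine ⟨fun t => -(a⁻¹ * Real.cos (a * t + b)), fun t => ?_, |a⁻¹|, fun t => ?_⟩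
  · have h : HasDerivAt (fun t : ℝ => a * t + b) a t := by
      simpa using ((hasDerivAt_id t).const_mul a).add_const b
    convert! (h.cos.const_mul a⁻¹).neg using 1
    field_simp
  · rw [abs_neg, abs_mul]
    exact mul_le_of_le_one_right (abs_nonneg _) (Real.abs_cos_le_one _)

/-- The product of two sinusoids is its mean value plus the derivative of a bounded function. -/
theorem exists_bounded_primitive_sin_mul_cos {a b : ℝ} (ha : 0 < a) (hb : 0 < b) (α β : ℝ) :
    ∃ W : ℝ → ℝ, (∀ t, HasDerivAt W (Real.sin (a * t + α) * Real.cos (b * t + β) -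
      if a = b then Real.sin (α - β) / 2 else 0) t) ∧ ∃ C, ∀ t, |W t| ≤ C := by
  have hprod : ∀ t, Real.sin (a * t + α) * Real.cos (b * t + β) =
      Real.sin ((a + b) * t + (α + β)) / 2 + Real.sin ((a - b) * t + (α - β)) / 2 := by
    intro t
    rw [show (a + b) * t + (α + β) = (a * t + α) + (b * t + β) by ring,
      show (a - b) * t + (α - β) = (a * t + α) - (b * t + β) by ring,
      Real.sin_add (a * t + α), Real.sin_sub (a * t + α)]
    ring
  obtain ⟨W, hW, C, hC⟩ := exists_bounded_primitive_sin (add_pos ha hb).ne' (α + β)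
  split_ifs with hab
  · refine ⟨fun t => W t / 2, fun t => ?_, C / 2, fun t => ?_⟩
    · rw [hprod]
      simpa [hab] using (hW t).div_const 2
    · rw [abs_div, abs_two]
      linarith [hC t]
  · obtain ⟨W', hW', C', hC'⟩ := exists_bounded_primitive_sin (sub_ne_zero.2 hab) (α - β)
    refine ⟨fun t => W t / 2 + W' t / 2, fun t => ?_, C / 2 + C' / 2, fun t => ?_⟩
    · rw [hprod, sub_zero]
      exact ((hW t).div_const 2).add ((hW' t).div_const 2)
    · refine (abs_add_le _ _).trans ?_
      rw [abs_div, abs_div, abs_two]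
      linarith [hC t, hC' t]

/-- The Lie derivative of a function along a vector field. -/
def lieDeriv {E : Type*} [NormedAddCommGroup E] [NormedSpace ℝ E] (X : E → E) (f : E → ℝ)
    (p : E) : ℝ :=
  fderiv ℝ f p (X p)

theorem hasDerivAt_comp_of_controlled {ι E : Type*} [Fintype ι] [NormedAddCommGroup E]
    [NormedSpace ℝ E] {X : ι → E → E} {u : ι → ℝ} {f : E → ℝ} {γ : ℝ → E} {t : ℝ}
    (hf : DifferentiableAt ℝ f (γ t)) (hγ : HasDerivAt γ (∑ i, u i • X i (γ t)) t) :
    HasDerivAt (fun s => f (γ s)) (∑ i, u i * lieDeriv (X i) f (γ t)) t := by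
  have := hf.hasFDerivAt.comp_hasDerivAt t hγ
  simpa [lieDeriv] using! this

/-- Two-step averaging: if the primitives `U` of the inputs and the primitives `V` of the
mean-free parts of the products `U i * u j` are bounded suitably, then a function `z` whose
averaged derivative is bounded below by `κ` grows at least linearly along trajectories. -/
theorem linear_growth_of_averaged {ι E : Type*} [Fintype ι] [NormedAddCommGroup E]
    [NormedSpace ℝ E] {X : ι → E → E} {u U : ι → ℝ → ℝ} {V : ι → ι → ℝ → ℝ} {m : ι → ι → ℝ}
    (hU : ∀ i t, HasDerivAt (U i) (u i t) t)
    (hV : ∀ i j t, HasDerivAt (V i j) (U i t * u j t - m i j) t)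
    {z : E → ℝ} {Ω : Set E} {κ : ℝ}
    (hz : ∀ p ∈ Ω, DifferentiableAt ℝ z p)
    (hz₁ : ∀ p ∈ Ω, ∀ i, DifferentiableAt ℝ (lieDeriv (X i) z) p)
    (hz₂ : ∀ p ∈ Ω, ∀ i j, DifferentiableAt ℝ (lieDeriv (X j) (lieDeriv (X i) z)) p)
    (hW : ∀ p ∈ Ω, ∀ t, |∑ i, U i t * lieDeriv (X i) z p -
      ∑ i, ∑ j, V i j t * lieDeriv (X j) (lieDeriv (X i) z) p| ≤ z p / 3)
    (hD : ∀ p ∈ Ω, ∀ t, κ ≤ -∑ i, ∑ j, m i j * lieDeriv (X j) (lieDeriv (X i) z) p +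
      ∑ i, ∑ j, V i j t *
        ∑ l, u l t * lieDeriv (X l) (lieDeriv (X j) (lieDeriv (X i) z)) p)
    {γ : ℝ → E} {t₀ t₁ : ℝ} (ht : t₀ ≤ t₁) (hγΩ : ∀ t ∈ Icc t₀ t₁, γ t ∈ Ω)
    (hγ : ∀ t ∈ Icc t₀ t₁, HasDerivAt γ (∑ i, u i t • X i (γ t)) t) :
    2 / 3 * z (γ t₀) + κ * (t₁ - t₀) ≤ 4 / 3 * z (γ t₁) := by
  set G : ℝ → ℝ := fun t => z (γ t) - (∑ i, U i t * lieDeriv (X i) z (γ t) -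
      ∑ i, ∑ j, V i j t * lieDeriv (X j) (lieDeriv (X i) z) (γ t)) with hG
  have hderiv : ∀ t ∈ Icc t₀ t₁, HasDerivAt G
      (-∑ i, ∑ j, m i j * lieDeriv (X j) (lieDeriv (X i) z) (γ t) +
        ∑ i, ∑ j, V i j t *
          ∑ l, u l t * lieDeriv (X l) (lieDeriv (X j) (lieDeriv (X i) z)) (γ t)) t := by
    intro t ht
    have hp := hγΩ t ht
    have h0 := hasDerivAt_comp_of_controlled (hz _ hp) (hγ t ht)
    have h1 := fun i => hasDerivAt_comp_of_controlled (hz₁ _ hp i) (hγ t ht)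
    have h2 := fun i j => hasDerivAt_comp_of_controlled (hz₂ _ hp i j) (hγ t ht)
    have hs1 := HasDerivAt.fun_sum (u := Finset.univ) fun i _ => (hU i t).mul (h1 i)
    have hs2 := HasDerivAt.fun_sum (u := Finset.univ) fun i _ =>
      HasDerivAt.fun_sum (u := Finset.univ) fun j _ => (hV i j t).mul (h2 i j)
    convert! h0.sub (hs1.sub hs2) using 1
    simp only [sub_mul, Finset.sum_add_distrib, Finset.sum_sub_distrib, Finset.mul_sum, mul_assoc]
    ring
  have hmono := (convex_Icc t₀ t₁).mul_sub_le_image_sub_of_le_deriv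
    (fun t ht => (hderiv t ht).continuousAt.continuousWithinAt)
    (fun t ht => (hderiv t (interior_subset ht)).differentiableAt.differentiableWithinAt)
    (C := κ) (fun t ht => by
      rw [(hderiv t (interior_subset ht)).deriv]
      exact hD _ (hγΩ t (interior_subset ht)) t)
    t₀ (left_mem_Icc.2 ht) t₁ (right_mem_Icc.2 ht) ht
  have hW0 := abs_le.1 (hW _ (hγΩ t₀ (left_mem_Icc.2 ht)) t₀)
  have hW1 := abs_le.1 (hW _ (hγΩ t₁ (right_mem_Icc.2 ht)) t₁)
  simp only [hG] at hmono
  linarith [hW0.2, hW1.1]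

namespace HomSymbol

variable {ι E : Type*} [NormedAddCommGroup E] [NormedSpace ℝ E] {B : ι → E → E}
  {σ : E → ℝ} {p₀ : E} {N : ℕ} {d e : ℤ} {f : E → ℝ}

theorem lieDeriv_smul (hσ : ∀ᶠ p in 𝓝[≠] p₀, 0 < σ p) {H : E → ℝ}
    (hH : HomSymbol B σ p₀ N e H) (hf : HomSymbol B σ p₀ (N + 1) d f) (k : ι) :
    HomSymbol B σ p₀ N (d + e - 1) (lieDeriv (fun p => H p • B k p) f) := by
  have h := hH.mul hσ (hf.fderiv_apply k)
  rw [show e + (d - 1) = d + e - 1 by ring] at h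
  exact h.congr (Eventually.of_forall fun p => by simp [lieDeriv])

theorem isLittleO (hσ : ∀ᶠ p in 𝓝[≠] p₀, 0 < σ p) (hσ0 : Tendsto σ (𝓝[≠] p₀) (𝓝 0))
    (hf : HomSymbol B σ p₀ N d f) (hed : e < d) : f =o[𝓝[≠] p₀] fun p => σ p ^ e := by
  refine hf.isBigO.trans_isLittleO ?_
  have hne : d - e ≠ 0 := by lia
  have h : Tendsto (fun p => σ p ^ (d - e)) (𝓝[≠] p₀) (𝓝 0) := by
    have := (continuousAt_zpow₀ (0 : ℝ) (d - e) (Or.inr (by lia))).tendsto.comp hσ0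
    rwa [zero_zpow _ hne] at this
  refine isLittleO_of_tendsto' ?_ (h.congr' ?_)
  · filter_upwards [hσ] with p hp hz using absurd hz (zpow_pos hp e).ne'
  · filter_upwards [hσ] with p hp using zpow_sub₀ hp.ne' d e

theorem of_le {M : ℕ} (h : M ≤ N) (hf : HomSymbol B σ p₀ N d f) : HomSymbol B σ p₀ M d f := by
  induction h with
  | refl => exact hf
  | step _ ih => exact ih hf.of_succ

/-- A function on `(0, ∞)` that behaves like `y` up to two derivatives yields a symbol of
degree two when composed with the squared gauge. -/
theorem comp_of_linear_bounds {ψ : E → ℝ} {h : ℝ → ℝ} (hψ : ∀ᶠ p in 𝓝[≠] p₀, 0 < ψ p)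
    (hψ0 : Tendsto ψ (𝓝[≠] p₀) (𝓝 0)) (hs : HomSymbol B (fun p => √(ψ p)) p₀ 2 2 ψ)
    (hh : ContDiffOn ℝ 2 h (Ioi 0))
    (h0 : ∃ C : ℝ, ∃ δ > (0 : ℝ), ∀ y ∈ Ioc (0 : ℝ) δ, |h y / y| ≤ C)
    (h1 : ∃ C : ℝ, ∃ δ > (0 : ℝ), ∀ y ∈ Ioc (0 : ℝ) δ, |deriv h y| ≤ C)
    (h2 : ∃ C : ℝ, ∃ δ > (0 : ℝ), ∀ y ∈ Ioc (0 : ℝ) δ, |deriv (deriv h) y * y| ≤ C) :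
    HomSymbol B (fun p => √(ψ p)) p₀ 2 2 fun p => h (ψ p) := by
  have hev : ∀ {δ : ℝ}, 0 < δ → ∀ᶠ y in 𝓝[>] (0 : ℝ), y ∈ Ioc (0 : ℝ) δ := fun hδ =>
    Ioc_mem_nhdsGT hδ
  have hh' := (contDiffOn_succ_iff_deriv_of_isOpen (n := 1) isOpen_Ioi).1 hh
  have hO0 : h =O[𝓝[>] 0] fun y => y ^ (1 : ℤ) := by
    obtain ⟨C, δ, hδ, hC⟩ := h0
    refine IsBigO.of_bound C ?_
    filter_upwards [hev hδ] with y hy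
    have := hC y hy
    rw [abs_div, div_le_iff₀ (abs_pos.2 hy.1.ne')] at this
    simpa using this
  have hO1 : deriv h =O[𝓝[>] 0] fun y => y ^ (0 : ℤ) := by
    obtain ⟨C, δ, hδ, hC⟩ := h1
    refine IsBigO.of_bound C ?_
    filter_upwards [hev hδ] with y hy
    simpa using hC y hy
  have hO2 : deriv (deriv h) =O[𝓝[>] 0] fun y => y ^ (-1 : ℤ) := by
    obtain ⟨C, δ, hδ, hC⟩ := h2
    refine IsBigO.of_bound C ?_
    filter_upwards [hev hδ] with y hy
    have := hC y hy
    rw [abs_mul, ← le_div_iff₀ (abs_pos.2 hy.1.ne')] at this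
    simpa [div_eq_mul_inv] using this
  have hdd : HomSymbol B (fun p => √(ψ p)) p₀ 0 (2 * 0 - 2) fun p => deriv (deriv h) (ψ p) :=
    isBigO_comp_sqrt_zpow (d := -1) hψ hψ0 hO2
  have hd : HomSymbol B (fun p => √(ψ p)) p₀ 1 (2 * 1 - 2) fun p => deriv h (ψ p) :=
    comp_succ (d := 0) hψ hψ0 (hh'.2.2.differentiableOn (by simp)) hO1 (hs.of_le (by simp)) hdd
  exact comp_succ (d := 1) hψ hψ0 (hh.differentiableOn (by simp)) hO0 hs hd

end HomSymbol

/-- At a nondegenerate minimum with value zero, `ψ` is a symbol of degree two with respect to the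
gauge `√ψ`. -/
theorem homSymbol_of_nondegenerate_min {ι E : Type*} [NormedAddCommGroup E] [NormedSpace ℝ E]
    {B : ι → E → E} (hB : ∀ j, ContDiff ℝ ∞ (B j)) {ψ : E → ℝ} (hψ : ContDiff ℝ ∞ ψ) {p₀ : E}
    (h0 : ψ p₀ = 0) (h1 : fderiv ℝ ψ p₀ = 0) (hpos : ∀ᶠ p in 𝓝[≠] p₀, 0 < ψ p) {m : ℝ}
    (hm : 0 < m) (hle : ∀ᶠ p in 𝓝 p₀, m * ‖p - p₀‖ ^ 2 ≤ ψ p) (N : ℕ) :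
    HomSymbol B (fun p => √(ψ p)) p₀ (N + 2) 2 ψ := by
  have hσ : ∀ᶠ p in 𝓝[≠] p₀, 0 < √(ψ p) := hpos.mono fun p hp => Real.sqrt_pos.2 hp
  have hσ1 : ∀ᶠ p in 𝓝[≠] p₀, √(ψ p) ≤ 1 := by
    have : ∀ᶠ p in 𝓝 p₀, √(ψ p) < 1 :=
      (Real.continuous_sqrt.comp hψ.continuous).continuousAt.eventually_lt continuousAt_const
        (by simp [h0])
    exact (this.filter_mono nhdsWithin_le_nhds).mono fun p hp => hp.le
  have hfd : ContDiff ℝ ∞ (fderiv ℝ ψ) := hψ.fderiv_right (by simp)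
  have hs : ∀ j, ContDiff ℝ ∞ fun p => fderiv ℝ ψ p (B j p) := fun j => hfd.clm_apply (hB j)
  have hnorm : (fun p => p - p₀) =O[𝓝[≠] p₀] fun p => √(ψ p) ^ (1 : ℤ) := by
    refine IsBigO.of_bound (√m)⁻¹ ?_
    filter_upwards [hle.filter_mono nhdsWithin_le_nhds] with p hp
    rw [zpow_one, Real.norm_of_nonneg (Real.sqrt_nonneg _), ← div_eq_inv_mul,
      le_div_iff₀ (Real.sqrt_pos.2 hm)]
    refine Real.le_sqrt_of_sq_le ?_
    rw [mul_pow, Real.sq_sqrt hm.le]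
    linarith
  have hd1 : ∀ j, (fun p => fderiv ℝ ψ p (B j p)) =O[𝓝[≠] p₀] fun p => √(ψ p) ^ (1 : ℤ) := by
    intro j
    have := (hs j).differentiable (by simp) p₀ |>.isBigO_sub
    simp only [h1, zero_apply, sub_zero] at this
    exact (this.mono nhdsWithin_le_nhds).trans hnorm
  refine ⟨?_, Eventually.of_forall fun p => hψ.differentiable (by simp) p, fun j =>
    ⟨hd1 j, Eventually.of_forall fun p => (hs j).differentiable (by simp) p, fun i => ?_⟩⟩
  · refine EventuallyEq.isBigO ?_
    filter_upwards [hpos] with p hp using (Real.sq_sqrt hp.le).symm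
  · exact HomSymbol.of_contDiff hB hσ hσ1
      (((hs j).fderiv_right (m := ∞) (by simp)).clm_apply (hB i))

end SmoothSymbols

/-- The two-step averaging corrections and remainder are dominated near the base point. -/
theorem eventually_averaging_corrections_le {ι κ E : Type*} [Fintype κ]
    [NormedAddCommGroup E] [NormedSpace ℝ E] {B : ι → E → E} {σ : E → ℝ} {p₀ : E}
    (hσ : ∀ᶠ p in 𝓝[≠] p₀, 0 < σ p) (hσ0 : Tendsto σ (𝓝[≠] p₀) (𝓝 0))
    {f₁ : κ → E → ℝ} {f₂ : κ → κ → E → ℝ} {f₃ : κ → κ → κ → E → ℝ}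
    (h₁ : ∀ i, HomSymbol B σ p₀ 2 (-1) (f₁ i)) (h₂ : ∀ i j, HomSymbol B σ p₀ 1 0 (f₂ i j))
    (h₃ : ∀ i j l, HomSymbol B σ p₀ 0 1 (f₃ i j l))
    {u U : κ → ℝ → ℝ} {V : κ → κ → ℝ → ℝ}
    (hu : ∀ i, ∃ C, ∀ t, |u i t| ≤ C) (hU : ∀ i, ∃ C, ∀ t, |U i t| ≤ C)
    (hV : ∀ i j, ∃ C, ∀ t, |V i j t| ≤ C) {ε : ℝ} (hε : 0 < ε) :
    ∀ᶠ p in 𝓝[≠] p₀, ∀ t,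
      |∑ i, U i t * f₁ i p - ∑ i, ∑ j, V i j t * f₂ i j p| ≤ ε * σ p ^ (-2 : ℤ) ∧
      |∑ i, ∑ j, V i j t * ∑ l, u l t * f₃ i j l p| ≤ ε := by
  choose Cu hu using hu
  choose CU hU using hU
  choose CV hV using hV
  have hCV : ∀ i j, 0 ≤ CV i j := fun i j => (abs_nonneg _).trans (hV i j 0)
  have e1 : (fun p => ∑ i, CU i * |f₁ i p| + ∑ i, ∑ j, CV i j * |f₂ i j p|)
      =o[𝓝[≠] p₀] fun p => σ p ^ (-2 : ℤ) :=
    (IsLittleO.fun_sum fun i _ => (((h₁ i).isLittleO hσ hσ0 (by lia)).abs_left).const_mul_left _).add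
      (IsLittleO.fun_sum fun i _ => IsLittleO.fun_sum fun j _ =>
        (((h₂ i j).isLittleO hσ hσ0 (by lia)).abs_left).const_mul_left _)
  have e2 : (fun p => ∑ i, ∑ j, CV i j * ∑ l, Cu l * |f₃ i j l p|)
      =o[𝓝[≠] p₀] fun p => σ p ^ (0 : ℤ) :=
    IsLittleO.fun_sum fun i _ => IsLittleO.fun_sum fun j _ => IsLittleO.const_mul_left
      (IsLittleO.fun_sum fun l _ =>
        (((h₃ i j l).isLittleO hσ hσ0 (by lia)).abs_left).const_mul_left _) _
  filter_upwards [hσ, e1.def hε, e2.def hε] with p hp b1 b2 t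
  rw [Real.norm_of_nonneg (zpow_nonneg hp.le _)] at b1 b2
  have b1 := (le_abs_self _).trans b1
  have b2 := (le_abs_self _).trans b2
  rw [zpow_zero, mul_one] at b2
  constructor
  · refine (abs_sub _ _).trans ((add_le_add ?_ ?_).trans b1)
    · refine (Finset.abs_sum_le_sum_abs _ _).trans (Finset.sum_le_sum fun i _ => ?_)
      rw [abs_mul]
      exact mul_le_mul_of_nonneg_right (hU i t) (abs_nonneg _)
    · refine (Finset.abs_sum_le_sum_abs _ _).trans (Finset.sum_le_sum fun i _ => ?_)
      refine (Finset.abs_sum_le_sum_abs _ _).trans (Finset.sum_le_sum fun j _ => ?_)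
      rw [abs_mul]
      exact mul_le_mul_of_nonneg_right (hV i j t) (abs_nonneg _)
  · refine le_trans ?_ b2
    refine (Finset.abs_sum_le_sum_abs _ _).trans (Finset.sum_le_sum fun i _ => ?_)
    refine (Finset.abs_sum_le_sum_abs _ _).trans (Finset.sum_le_sum fun j _ => ?_)
    rw [abs_mul]
    refine mul_le_mul (hV i j t) ?_ (abs_nonneg _) (hCV i j)
    refine (Finset.abs_sum_le_sum_abs _ _).trans (Finset.sum_le_sum fun l _ => ?_)
    rw [abs_mul]
    exact mul_le_mul_of_nonneg_right (hu l t) (abs_nonneg _)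

/-- The sinusoidal inputs `√ω_k cos(ω_k t + φ_k)` and `√ω_k sin(ω_k t + φ_k)`, indexed by `false`
and `true` and written uniformly as phase-shifted cosines. -/
def sinusoidalInput {K : Type*} (ω φ : K → ℝ) (i : K × Bool) (t : ℝ) : ℝ :=
  √(ω i.1) * Real.cos (ω i.1 * t + (φ i.1 - cond i.2 (Real.pi / 2) 0))

/-- The mean of the product of the primitive of the `i`-th sinusoidal input and the `j`-th
sinusoidal input. -/
def sinusoidalMean {K : Type*} [DecidableEq K] (i j : K × Bool) : ℝ :=
  if i.1 = j.1 then Real.sin (cond j.2 (Real.pi / 2) 0 - cond i.2 (Real.pi / 2) 0) / 2 else 0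

theorem abs_sinusoidalInput_le {K : Type*} (ω φ : K → ℝ) (i : K × Bool) (t : ℝ) :
    |sinusoidalInput ω φ i t| ≤ √(ω i.1) := by
  rw [sinusoidalInput, abs_mul, abs_of_nonneg (Real.sqrt_nonneg _)]
  exact mul_le_of_le_one_right (Real.sqrt_nonneg _) (Real.abs_cos_le_one _)

theorem exists_primitives_sinusoidalInput {K : Type*} [DecidableEq K] {ω : K → ℝ} (φ : K → ℝ)
    (hω : ∀ k, 0 < ω k) (hinj : Function.Injective ω) :
    ∃ (U : K × Bool → ℝ → ℝ) (V : K × Bool → K × Bool → ℝ → ℝ),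
      (∀ i t, HasDerivAt (U i) (sinusoidalInput ω φ i t) t) ∧
      (∀ i j t, HasDerivAt (V i j) (U i t * sinusoidalInput ω φ j t - sinusoidalMean i j) t) ∧
      (∀ i, ∃ C, ∀ t, |U i t| ≤ C) ∧ ∀ i j, ∃ C, ∀ t, |V i j t| ≤ C := by
  set α : K × Bool → ℝ := fun i => φ i.1 - cond i.2 (Real.pi / 2) 0 with hα
  have hW := fun i j : K × Bool =>
    exists_bounded_primitive_sin_mul_cos (hω i.1) (hω j.1) (α i) (α j)
  choose W hWd hWb using hW
  have hs : ∀ i : K × Bool, 0 < √(ω i.1) := fun i => Real.sqrt_pos.2 (hω i.1)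
  refine ⟨fun i t => (√(ω i.1))⁻¹ * Real.sin (ω i.1 * t + α i),
    fun i j t => (√(ω i.1))⁻¹ * √(ω j.1) * W i j t, fun i t => ?_, fun i j t => ?_, fun i => ?_,
    fun i j => ?_⟩
  · have h : HasDerivAt (fun t : ℝ => ω i.1 * t + α i) (ω i.1) t := by
      simpa using ((hasDerivAt_id t).const_mul (ω i.1)).add_const (α i)
    convert! h.sin.const_mul (√(ω i.1))⁻¹ using 1
    rw [sinusoidalInput]
    have := Real.mul_self_sqrt (hω i.1).le
    field_simp [(hs i).ne']
    rw [pow_two, this]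
  · convert! (hWd i j t).const_mul ((√(ω i.1))⁻¹ * √(ω j.1)) using 1
    have hm : (√(ω i.1))⁻¹ * √(ω j.1) *
        (if ω i.1 = ω j.1 then Real.sin (α i - α j) / 2 else 0) = sinusoidalMean i j := by
      rw [sinusoidalMean]
      by_cases h : i.1 = j.1
      · rw [if_pos h, if_pos (by rw [h]), h, inv_mul_cancel₀ (hs j).ne', one_mul]
        simp only [hα, h]
        congr 2
        ring
      · rw [if_neg h, if_neg fun h' => h (hinj h'), mul_zero]
    rw [mul_sub, hm, sinusoidalInput]
    ring
  · refine ⟨(√(ω i.1))⁻¹, fun t => ?_⟩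
    rw [abs_mul, abs_of_pos (inv_pos.2 (hs i))]
    exact mul_le_of_le_one_right (inv_pos.2 (hs i)).le (Real.abs_sin_le_one _)
  · obtain ⟨C, hC⟩ := hWb i j
    refine ⟨(√(ω i.1))⁻¹ * √(ω j.1) * C, fun t => ?_⟩
    have hpos : 0 < (√(ω i.1))⁻¹ * √(ω j.1) := mul_pos (inv_pos.2 (hs i)) (hs j)
    rw [abs_mul, abs_of_pos hpos]
    exact mul_le_mul_of_nonneg_left (hC t) hpos.le

theorem sum_sinusoidalMean_mul {K : Type*} [Fintype K] [DecidableEq K]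
    (Q : K × Bool → K × Bool → ℝ) :
    ∑ i, ∑ j, sinusoidalMean i j * Q i j =
      ∑ k, (Q (k, false) (k, true) - Q (k, true) (k, false)) / 2 := by
  simp only [Fintype.sum_prod_type, Fintype.sum_bool, sinusoidalMean]
  refine Finset.sum_congr rfl fun k _ => ?_
  simp [ite_mul]
  ring

/-- The Lie bracket of two multiples of the same vector field, applied to a function. -/
theorem lieDeriv_bracket_smul {E : Type*} [NormedAddCommGroup E] [NormedSpace ℝ E]
    {Y : E → E} {H₁ H₂ z : E → ℝ} {p : E} (h₁ : DifferentiableAt ℝ H₁ p)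
    (h₂ : DifferentiableAt ℝ H₂ p) (hz : DifferentiableAt ℝ (lieDeriv Y z) p) :
    lieDeriv (fun q => H₁ q • Y q) (lieDeriv (fun q => H₂ q • Y q) z) p -
      lieDeriv (fun q => H₂ q • Y q) (lieDeriv (fun q => H₁ q • Y q) z) p =
      (H₁ p * lieDeriv Y H₂ p - H₂ p * lieDeriv Y H₁ p) * lieDeriv Y z p := by
  have hfun : ∀ H : E → ℝ, lieDeriv (fun q => H q • Y q) z = fun q => H q * lieDeriv Y z q := by
    intro H
    ext q
    simp [lieDeriv]
  rw [hfun, hfun]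
  clear hfun
  generalize lieDeriv Y z = g at hz ⊢
  simp only [lieDeriv]
  rw [fderiv_fun_mul h₂ hz, fderiv_fun_mul h₁ hz]
  simp
  ring

theorem lieDeriv_comp {E : Type*} [NormedAddCommGroup E] [NormedSpace ℝ E]
    {Y : E → E} {ψ : E → ℝ} {h : ℝ → ℝ} {h' : ℝ} {p : E} (hh : HasDerivAt h h' (ψ p))
    (hψ : DifferentiableAt ℝ ψ p) :
    lieDeriv Y (fun q => h (ψ q)) p = h' * lieDeriv Y ψ p := by
  rw [lieDeriv, HasFDerivAt.fderiv (f := fun q => h (ψ q)) (hh.comp_hasFDerivAt p hψ.hasFDerivAt)]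
  simp [lieDeriv]

/-- The averaged system makes `1 / ψ` grow at a rate controlled by the derivative of `ψ` along
the vector field. -/
theorem le_lieDeriv_bracket_inv {E : Type*} [NormedAddCommGroup E] [NormedSpace ℝ E]
    {Y : E → E} {ψ : E → ℝ} {h₁ h₂ : ℝ → ℝ} {p : E} {c : ℝ} (hp : 0 < ψ p)
    (hψ : DifferentiableAt ℝ ψ p) (hd₁ : DifferentiableAt ℝ h₁ (ψ p))
    (hd₂ : DifferentiableAt ℝ h₂ (ψ p))
    (hz : DifferentiableAt ℝ (lieDeriv Y fun q => (ψ q)⁻¹) p)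
    (hc : deriv h₂ (ψ p) * h₁ (ψ p) - deriv h₁ (ψ p) * h₂ (ψ p) ≤ -c * ψ p) :
    c * (lieDeriv Y ψ p) ^ 2 / ψ p ≤
      lieDeriv (fun q => h₁ (ψ q) • Y q) (lieDeriv (fun q => h₂ (ψ q) • Y q) fun q => (ψ q)⁻¹) p -
        lieDeriv (fun q => h₂ (ψ q) • Y q)
          (lieDeriv (fun q => h₁ (ψ q) • Y q) fun q => (ψ q)⁻¹) p := by
  rw [lieDeriv_bracket_smul (H₁ := fun q => h₁ (ψ q)) (H₂ := fun q => h₂ (ψ q))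
      (hd₁.comp p hψ) (hd₂.comp p hψ) hz,
    lieDeriv_comp hd₁.hasDerivAt hψ, lieDeriv_comp hd₂.hasDerivAt hψ,
    lieDeriv_comp (hasDerivAt_inv hp.ne') hψ]
  set D := lieDeriv Y ψ p
  have h := mul_le_mul_of_nonneg_right hc (by positivity : 0 ≤ D ^ 2 / ψ p ^ 2)
  have e1 : c * D ^ 2 / ψ p = -(-c * ψ p * (D ^ 2 / ψ p ^ 2)) := by field_simp
  rw [e1, neg_le_iff_add_nonneg]
  refine le_trans (sub_nonneg.2 h) (le_of_eq ?_)
  field_simp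
  ring

/-- The control vector fields `h₁(ψ) B_k` and `h₂(ψ) B_k` of the closed-loop system. -/
def outputField {K E : Type*} [NormedAddCommGroup E] [NormedSpace ℝ E] (B : K → E → E)
    (ψ : E → ℝ) (h₁ h₂ : ℝ → ℝ) (i : K × Bool) (p : E) : E :=
  cond i.2 (h₂ (ψ p)) (h₁ (ψ p)) • B i.1 p

section Averaging

variable {K E : Type*} [Fintype K] [NormedAddCommGroup E] [NormedSpace ℝ E] {B : K → E → E}
  {ψ : E → ℝ} {h₁ h₂ : ℝ → ℝ} {p₀ : E}

/-- The averaged decay rate: along the bracket directions, `1 / ψ` grows at a positive rate near a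
nondegenerate minimum. -/
theorem exists_pos_le_neg_sum_sinusoidalMean [DecidableEq K] (hψ : ContDiff ℝ (⊤ : ℕ∞) ψ)
    (h0 : ψ p₀ = 0) (h1 : fderiv ℝ ψ p₀ = 0) (hpos : ∀ᶠ p in 𝓝[≠] p₀, 0 < ψ p) {m : ℝ}
    (hm : 0 < m)
    (hle : ∀ᶠ p in 𝓝 p₀, m * ‖p - p₀‖ ^ 2 ≤ ∑ k, (fderiv ℝ ψ p (B k p)) ^ 2)
    (hh : GoodPair h₁ h₂)
    (hz : ∀ k, ∀ᶠ p in 𝓝[≠] p₀, DifferentiableAt ℝ (lieDeriv (B k) fun q => (ψ q)⁻¹) p) :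
    ∃ κ > 0, ∀ᶠ p in 𝓝[≠] p₀, κ ≤ -∑ i, ∑ j, sinusoidalMean i j *
      lieDeriv (outputField B ψ h₁ h₂ j)
        (lieDeriv (outputField B ψ h₁ h₂ i) fun q => (ψ q)⁻¹) p := by
  obtain ⟨-, -, -, hc₁, hc₂, -, -, -, r, hr, c, hc, hrc⟩ := hh
  obtain ⟨C, hC, hCle⟩ := (isBigO_sq_of_fderiv_eq_zero hψ h0 h1).exists_pos
  refine ⟨c * m / (2 * C), by positivity, ?_⟩
  have hsmall : ∀ᶠ p in 𝓝 p₀, ψ p < r :=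
    hψ.continuous.continuousAt.eventually_lt continuousAt_const (by simpa [h0] using hr)
  filter_upwards [hpos, hsmall.filter_mono nhdsWithin_le_nhds, hle.filter_mono nhdsWithin_le_nhds,
    hCle.bound.filter_mono nhdsWithin_le_nhds, eventually_all.2 hz] with p hp hpr hlep hCp hzp
  rw [Real.norm_of_nonneg hp.le, Real.norm_of_nonneg (by positivity)] at hCp
  have hd₁ : DifferentiableAt ℝ h₁ (ψ p) :=
    (hc₁.contDiffAt (Ioi_mem_nhds hp)).differentiableAt (by simp)
  have hd₂ : DifferentiableAt ℝ h₂ (ψ p) :=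
    (hc₂.contDiffAt (Ioi_mem_nhds hp)).differentiableAt (by simp)
  have hbr := fun k => le_lieDeriv_bracket_inv (Y := B k) hp (hψ.differentiable (by simp) p)
    hd₁ hd₂ (hzp k) (hrc _ ⟨hp, hpr.le⟩)
  rw [sum_sinusoidalMean_mul (fun i j => lieDeriv (outputField B ψ h₁ h₂ j)
        (lieDeriv (outputField B ψ h₁ h₂ i) fun q => (ψ q)⁻¹) p), ← Finset.sum_neg_distrib]
  calc c * m / (2 * C) ≤ c / (2 * ψ p) * (m * ‖p - p₀‖ ^ 2) := by
        rw [div_mul_eq_mul_div, div_le_div_iff₀ (by positivity) (by positivity)]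
        have := mul_le_mul_of_nonneg_left hCp (by positivity : 0 ≤ 2 * (c * m))
        linarith
    _ ≤ c / (2 * ψ p) * ∑ k, (fderiv ℝ ψ p (B k p)) ^ 2 :=
        mul_le_mul_of_nonneg_left hlep (by positivity)
    _ ≤ _ := by
        rw [Finset.mul_sum]
        refine Finset.sum_le_sum fun k _ => ?_
        have hk : _ ≤ lieDeriv (outputField B ψ h₁ h₂ (k, false))
            (lieDeriv (outputField B ψ h₁ h₂ (k, true)) fun q => (ψ q)⁻¹) p -
            lieDeriv (outputField B ψ h₁ h₂ (k, true))
              (lieDeriv (outputField B ψ h₁ h₂ (k, false)) fun q => (ψ q)⁻¹) p := hbr k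
        have e : c / (2 * ψ p) * (fderiv ℝ ψ p (B k p)) ^ 2 =
            c * (lieDeriv (B k) ψ p) ^ 2 / ψ p / 2 := by
          rw [lieDeriv]
          field_simp
        rw [e]
        linarith

theorem exists_averaging_rate (hB : ∀ j, ContDiff ℝ (⊤ : ℕ∞) (B j))
    (hψ : ContDiff ℝ (⊤ : ℕ∞) ψ) (h0 : ψ p₀ = 0) (h1 : fderiv ℝ ψ p₀ = 0)
    (hpos : ∀ᶠ p in 𝓝[≠] p₀, 0 < ψ p) {m m' : ℝ} (hm : 0 < m)
    (hle : ∀ᶠ p in 𝓝 p₀, m * ‖p - p₀‖ ^ 2 ≤ ψ p) (hm' : 0 < m')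
    (hle' : ∀ᶠ p in 𝓝 p₀, m' * ‖p - p₀‖ ^ 2 ≤ ∑ k, (fderiv ℝ ψ p (B k p)) ^ 2)
    (hh : GoodPair h₁ h₂) {ω : K → ℝ} (φ : K → ℝ) (hω : ∀ k, 0 < ω k)
    (hinj : Function.Injective ω) :
    ∃ c > 0, ∃ Ω ∈ 𝓝[≠] p₀, ∀ (γ : ℝ → E) (t₀ t₁ : ℝ), t₀ ≤ t₁ →
      (∀ t ∈ Icc t₀ t₁, γ t ∈ Ω) →
      (∀ t ∈ Icc t₀ t₁,
        HasDerivAt γ (∑ i, sinusoidalInput ω φ i t • outputField B ψ h₁ h₂ i (γ t)) t) →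
      ψ (γ t₁) ≤ 2 * ψ (γ t₀) / (1 + c * ψ (γ t₀) * (t₁ - t₀)) := by
  classical
  obtain ⟨U, V, hU, hV, hUb, hVb⟩ := exists_primitives_sinusoidalInput φ hω hinj
  set X := outputField B ψ h₁ h₂ with hX
  set z : E → ℝ := fun q => (ψ q)⁻¹ with hzdef
  have hσ : ∀ᶠ p in 𝓝[≠] p₀, 0 < √(ψ p) := hpos.mono fun p hp => Real.sqrt_pos.2 hp
  have hψ0 : Tendsto ψ (𝓝[≠] p₀) (𝓝 0) := by
    simpa [h0] using hψ.continuous.continuousAt.tendsto.mono_left (nhdsWithin_le_nhds (a := p₀))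
  have hσ0 : Tendsto (fun p => √(ψ p)) (𝓝[≠] p₀) (𝓝 0) := by
    simpa [Function.comp_def] using (Real.continuous_sqrt.tendsto 0).comp hψ0
  have hs := homSymbol_of_nondegenerate_min hB hψ h0 h1 hpos hm hle 1
  have hz := HomSymbol.inv_of_sqrt hpos hs
  have hH : ∀ b : Bool, HomSymbol B (fun p => √(ψ p)) p₀ 2 2
      fun p => cond b (h₂ (ψ p)) (h₁ (ψ p)) := by
    obtain ⟨-, -, -, hc₁, hc₂, ⟨C₀, δ₀, hδ₀, a₀⟩, ⟨C₁, δ₁, hδ₁, a₁⟩, ⟨C₂, δ₂, hδ₂, a₂⟩, -⟩ := hh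
    rintro (_ | _)
    · exact HomSymbol.comp_of_linear_bounds hpos hψ0 hs.of_succ hc₁
        ⟨C₀, δ₀, hδ₀, fun y hy => (a₀ y hy).1⟩ ⟨C₁, δ₁, hδ₁, fun y hy => (a₁ y hy).1⟩
        ⟨C₂, δ₂, hδ₂, fun y hy => (a₂ y hy).1⟩
    · exact HomSymbol.comp_of_linear_bounds hpos hψ0 hs.of_succ hc₂
        ⟨C₀, δ₀, hδ₀, fun y hy => (a₀ y hy).2⟩ ⟨C₁, δ₁, hδ₁, fun y hy => (a₁ y hy).2⟩
        ⟨C₂, δ₂, hδ₂, fun y hy => (a₂ y hy).2⟩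
  have s₁ : ∀ i, HomSymbol B (fun p => √(ψ p)) p₀ 2 (-1) (lieDeriv (X i) z) := fun i =>
    HomSymbol.lieDeriv_smul hσ (hH i.2) hz i.1
  have s₂ : ∀ i j, HomSymbol B (fun p => √(ψ p)) p₀ 1 0 (lieDeriv (X j) (lieDeriv (X i) z)) :=
    fun i j => HomSymbol.lieDeriv_smul hσ (hH j.2).of_succ (s₁ i) j.1
  have s₃ : ∀ i j l, HomSymbol B (fun p => √(ψ p)) p₀ 0 1
      (lieDeriv (X l) (lieDeriv (X j) (lieDeriv (X i) z))) := fun i j l =>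
    HomSymbol.lieDeriv_smul hσ (hH l.2).of_succ.of_succ (s₂ i j) l.1
  obtain ⟨κ, hκ, hdrift⟩ := exists_pos_le_neg_sum_sinusoidalMean hψ h0 h1 hpos hm' hle' hh
    fun k => (hz.fderiv_apply k).differentiableAt
  have hub : ∀ i, ∃ C, ∀ t, |sinusoidalInput ω φ i t| ≤ C := fun i =>
    ⟨_, abs_sinusoidalInput_le ω φ i⟩
  have hW := eventually_averaging_corrections_le hσ hσ0 s₁ s₂ s₃ hub hUb hVb
    (show (0 : ℝ) < 1 / 3 by norm_num)
  have hR := eventually_averaging_corrections_le hσ hσ0 s₁ s₂ s₃ hub hUb hVb (half_pos hκ)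
  refine ⟨3 / 4 * κ, by positivity, _, hpos.and (hz.differentiableAt.and
    ((eventually_all.2 fun i => (s₁ i).differentiableAt).and
    ((eventually_all.2 fun i => eventually_all.2 fun j => (s₂ i j).differentiableAt).and
    (hdrift.and (hW.and hR))))), fun γ t₀ t₁ ht hγΩ hγ => ?_⟩
  have hgrow := linear_growth_of_averaged (κ := κ / 2) (z := z) hU hV (fun p hp => hp.2.1)
    (fun p hp => hp.2.2.1) (fun p hp => hp.2.2.2.1) (fun p hp t => by
      have h := (hp.2.2.2.2.2.1 t).1
      rw [zpow_neg, zpow_ofNat, Real.sq_sqrt hp.1.le] at h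
      exact h.trans_eq (by ring))
    (fun p hp t => by
      have h := (abs_le.1 (hp.2.2.2.2.2.2 t).2).1
      have := hp.2.2.2.2.1
      linarith) ht hγΩ hγ
  have p0 : 0 < ψ (γ t₀) := (hγΩ t₀ (left_mem_Icc.2 ht)).1
  have p1 : 0 < ψ (γ t₁) := (hγΩ t₁ (right_mem_Icc.2 ht)).1
  have hden : 0 < 1 + 3 / 4 * κ * ψ (γ t₀) * (t₁ - t₀) := by
    have := sub_nonneg.2 ht
    positivity
  rw [le_div_iff₀ hden]
  simp only [hzdef] at hgrow
  have h := mul_le_mul_of_nonneg_left hgrow (by positivity : 0 ≤ ψ (γ t₀) * ψ (γ t₁) * (3 / 2))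
  have e : ψ (γ t₀) * ψ (γ t₁) * (3 / 2) * (2 / 3 * (ψ (γ t₀))⁻¹ + κ / 2 * (t₁ - t₀)) =
      ψ (γ t₁) * (1 + 3 / 4 * κ * ψ (γ t₀) * (t₁ - t₀)) := by
    field_simp
    ring
  rw [e] at h
  exact h.trans_eq (by field_simp; ring)

end Averaging

theorem lipschitzOnWith_Iic_of_deriv_bounded {h : ℝ → ℝ} (h0 : ∀ y ≤ (0 : ℝ), h y = 0)
    (hc : ContDiffOn ℝ 2 h (Ioi 0))
    (hlin : ∃ C : ℝ, ∃ δ > (0 : ℝ), ∀ y ∈ Ioc (0 : ℝ) δ, |h y / y| ≤ C)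
    (hder : ∃ C : ℝ, ∃ δ > (0 : ℝ), ∀ y ∈ Ioc (0 : ℝ) δ, |deriv h y| ≤ C) :
    ∃ K : ℝ≥0, ∃ δ > (0 : ℝ), ∀ δ' ≤ δ, LipschitzOnWith K h (Iic δ') := by
  obtain ⟨C, δ, hδ, hC⟩ := hlin
  obtain ⟨D, η, hη, hD⟩ := hder
  have hC0 : 0 ≤ C := (abs_nonneg _).trans (hC δ ⟨hδ, le_rfl⟩)
  have hD0 : 0 ≤ D := (abs_nonneg _).trans (hD η ⟨hη, le_rfl⟩)
  refine ⟨(max C D).toNNReal, min δ η, lt_min hδ hη, fun δ' hδ' => ?_⟩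
  have hδ₁ : δ' ≤ δ := hδ'.trans (min_le_left _ _)
  have hδ₂ : δ' ≤ η := hδ'.trans (min_le_right _ _)
  refine LipschitzOnWith.of_dist_le_mul fun x hx y hy => ?_
  rw [Real.coe_toNNReal _ (hC0.trans (le_max_left _ _)), Real.dist_eq, Real.dist_eq]
  have hpos : ∀ x y : ℝ, x ≤ y → y ≤ δ' → |h x - h y| ≤ max C D * |x - y| := by
    intro x y hxy hyδ
    rcases le_or_gt y 0 with hy0 | hy0
    · rw [h0 y hy0, h0 x (hxy.trans hy0), sub_zero, abs_zero]
      positivity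
    rcases le_or_gt x 0 with hx0 | hx0
    · have hy' := hC y ⟨hy0, hyδ.trans hδ₁⟩
      rw [abs_div, div_le_iff₀ (abs_pos.2 hy0.ne'), abs_of_pos hy0] at hy'
      rw [h0 x hx0, zero_sub, abs_neg, abs_of_nonpos (by linarith : x - y ≤ 0)]
      exact hy'.trans (mul_le_mul (le_max_left _ _) (by linarith) hy0.le
        (hC0.trans (le_max_left _ _)))
    · have := (convex_Ioc (0 : ℝ) δ').norm_image_sub_le_of_norm_deriv_le (f := h) (C := D)
        (fun w hw => (hc.contDiffAt (Ioi_mem_nhds hw.1)).differentiableAt (by simp))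
        (fun w hw => hD w ⟨hw.1, hw.2.trans hδ₂⟩) (x := y) (y := x) ⟨hy0, hyδ⟩
        ⟨hx0, hxy.trans hyδ⟩
      exact this.trans (mul_le_mul_of_nonneg_right (le_max_right _ _) (abs_nonneg _))
  rcases le_total x y with hxy | hxy
  · exact hpos x y hxy hy
  · rw [abs_sub_comm, abs_sub_comm x y]
    exact hpos y x hxy hx

theorem LipschitzWith.smul_of_bounded {E F : Type*} [PseudoMetricSpace E]
    [SeminormedAddCommGroup F] [NormedSpace ℝ F] {a : E → ℝ} {b : E → F} {Ka Kb La Lb : ℝ≥0}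
    (ha : LipschitzWith Ka a) (hb : LipschitzWith Kb b) (hLa : ∀ p, ‖a p‖ ≤ La)
    (hLb : ∀ p, ‖b p‖ ≤ Lb) : LipschitzWith (La * Kb + Ka * Lb) fun p => a p • b p := by
  refine LipschitzWith.of_dist_le_mul fun x y => ?_
  have e : a x • b x - a y • b y = a x • (b x - b y) + (a x - a y) • b y := by
    rw [smul_sub, sub_smul]
    abel
  rw [dist_eq_norm, e]
  refine (norm_add_le _ _).trans ?_
  rw [norm_smul, norm_smul, ← dist_eq_norm, ← dist_eq_norm]
  have h₁ := mul_le_mul (hLa x) (hb.dist_le_mul x y) dist_nonneg La.2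
  have h₂ := mul_le_mul (ha.dist_le_mul x y) (hLb y) (norm_nonneg _)
    (mul_nonneg Ka.2 dist_nonneg)
  push_cast
  linarith

/-- A vector field of the form `h(ψ) Y` can be changed outside a ball to a bounded Lipschitz
vector field. -/
theorem exists_bounded_lipschitz_eqOn_closedBall {E : Type*} [NormedAddCommGroup E]
    [InnerProductSpace ℝ E] [FiniteDimensional ℝ E] {ψ : E → ℝ} (hψ : ContDiff ℝ (⊤ : ℕ∞) ψ)
    {Y : E → E} (hY : ContDiff ℝ (⊤ : ℕ∞) Y) {h : ℝ → ℝ} {K : ℝ≥0} {δ : ℝ}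
    (hh : LipschitzOnWith K h (Iic δ)) {p₀ : E} {R : ℝ} (hR : 0 < R)
    (hle : ∀ p ∈ closedBall p₀ R, ψ p ≤ δ) :
    ∃ g : E → E, (∃ L, LipschitzWith L g) ∧ (∃ L : ℝ≥0, ∀ p, ‖g p‖ ≤ L) ∧
      EqOn g (fun p => h (ψ p) • Y p) (closedBall p₀ R) := by
  let χ : ContDiffBump p₀ := ⟨R, R + 1, hR, by linarith⟩
  have hs₁ : HasCompactSupport fun p => χ p * ψ p := χ.hasCompactSupport.mul_right
  have hs₂ : HasCompactSupport fun p => χ p • Y p := χ.hasCompactSupport.smul_right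
  have hc₁ : ContDiff ℝ (⊤ : ℕ∞) fun p => χ p * ψ p := χ.contDiff.mul hψ
  have hc₂ : ContDiff ℝ (⊤ : ℕ∞) fun p => χ p • Y p := χ.contDiff.smul hY
  obtain ⟨K₁, hK₁⟩ := hc₁.lipschitzWith_of_hasCompactSupport hs₁ (by simp)
  obtain ⟨K₂, hK₂⟩ := hc₂.lipschitzWith_of_hasCompactSupport hs₂ (by simp)
  obtain ⟨L₁, hL₁⟩ : ∃ L : ℝ≥0, ∀ p, ‖χ p * ψ p‖ ≤ L :=
    let ⟨C, hC⟩ := hs₁.exists_bound_of_continuous hc₁.continuous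
    ⟨C.toNNReal, fun p => (hC p).trans (Real.le_coe_toNNReal C)⟩
  obtain ⟨L₂, hL₂⟩ : ∃ L : ℝ≥0, ∀ p, ‖χ p • Y p‖ ≤ L :=
    let ⟨C, hC⟩ := hs₂.exists_bound_of_continuous hc₂.continuous
    ⟨C.toNNReal, fun p => (hC p).trans (Real.le_coe_toNNReal C)⟩
  have hmin : LipschitzWith K fun y => h (min y δ) := by
    refine LipschitzWith.of_dist_le_mul fun x y => ?_
    refine (hh.dist_le_mul _ (min_le_right x δ) _ (min_le_right y δ)).trans ?_
    exact mul_le_mul_of_nonneg_left (by simpa [Real.dist_eq] using abs_min_sub_min_le_max x δ y δ)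
      K.2
  have hL : ∀ p, ‖h (min (χ p * ψ p) δ)‖ ≤ (‖h (min 0 δ)‖₊ + K * L₁ : ℝ≥0) := by
    intro p
    have h₁ := hmin.dist_le_mul (χ p * ψ p) 0
    rw [dist_zero_right, dist_eq_norm] at h₁
    have h₂ := mul_le_mul_of_nonneg_left (hL₁ p) K.coe_nonneg
    have h₃ := norm_le_norm_add_norm_sub (h (min 0 δ)) (h (min (χ p * ψ p) δ))
    rw [norm_sub_rev] at h₃
    push_cast
    linarith
  refine ⟨fun p => h (min (χ p * ψ p) δ) • χ p • Y p,
    ⟨_, LipschitzWith.smul_of_bounded (hmin.comp hK₁) hK₂ hL hL₂⟩,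
    ⟨(‖h (min 0 δ)‖₊ + K * L₁) * L₂, fun p => ?_⟩, fun p hp => ?_⟩
  · rw [norm_smul]
    exact mul_le_mul (hL p) (hL₂ p) (norm_nonneg _) (NNReal.coe_nonneg _)
  · have : χ p = 1 := χ.one_of_mem_closedBall hp
    simp only [this, one_mul, one_smul]
    rw [min_eq_left (hle p hp)]

theorem exists_global_solution_controlled {ι E : Type*} [Fintype ι] [NormedAddCommGroup E]
    [NormedSpace ℝ E] [CompleteSpace E] {g : ι → E → E} {u : ι → ℝ → ℝ}
    (hg : ∀ i, ∃ L, LipschitzWith L (g i)) (hgb : ∀ i, ∃ L : ℝ≥0, ∀ p, ‖g i p‖ ≤ L)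
    (hu : ∀ i, Continuous (u i)) (hub : ∀ i, ∃ C : ℝ, ∀ t, |u i t| ≤ C) (t₀ : ℝ) (x₀ : E) :
    ∃ γ : ℝ → E, γ t₀ = x₀ ∧ ∀ t, HasDerivAt γ (∑ i, u i t • g i (γ t)) t := by
  choose L hL using hg
  choose M hM using hgb
  choose C hC using hub
  have hC' : ∀ i t, ‖u i t‖ ≤ ((C i).toNNReal : ℝ) := fun i t =>
    (hC i t).trans (Real.le_coe_toNNReal _)
  refine exists_global_solution_of_lipschitz_of_bounded (F := fun t x => ∑ i, u i t • g i x)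
    (K := ∑ i, (C i).toNNReal * L i) (L := ∑ i, (C i).toNNReal * M i)
    (fun t => LipschitzWith.of_dist_le_mul fun x y => ?_)
    (fun x => continuous_finsetSum _ fun i _ => (hu i).smul continuous_const)
    (fun t x => ?_) t₀ x₀
  · rw [dist_eq_norm, ← Finset.sum_sub_distrib]
    push_cast
    rw [Finset.sum_mul]
    refine (norm_sum_le _ _).trans (Finset.sum_le_sum fun i _ => ?_)
    rw [← smul_sub, norm_smul, ← dist_eq_norm, mul_assoc]
    exact mul_le_mul (hC' i t) ((hL i).dist_le_mul x y) dist_nonneg (NNReal.coe_nonneg _)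
  · push_cast
    refine (norm_sum_le _ _).trans (Finset.sum_le_sum fun i _ => ?_)
    rw [norm_smul]
    exact mul_le_mul (hC' i t) (hM i x) (norm_nonneg _) (NNReal.coe_nonneg _)

theorem exp_mul_le_of_mul_le_deriv {g g' : ℝ → ℝ} {K a b : ℝ} (hab : a ≤ b)
    (hg : ∀ t ∈ Icc a b, HasDerivAt g (g' t) t) (hK : ∀ t ∈ Icc a b, K * g t ≤ g' t) :
    g a * Real.exp (K * (b - a)) ≤ g b := by
  have hd : ∀ t ∈ Icc a b, HasDerivAt (fun s => g s * Real.exp (-K * (s - b)))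
      (g' t * Real.exp (-K * (t - b)) + g t * (Real.exp (-K * (t - b)) * -K)) t := by
    intro t ht
    have h : HasDerivAt (fun s : ℝ => -K * (s - b)) (-K) t := by
      simpa using ((hasDerivAt_id t).sub_const b).const_mul (-K)
    exact (hg t ht).mul h.exp
  have hmono := monotoneOn_of_deriv_nonneg (convex_Icc a b)
    (fun t ht => (hd t ht).continuousAt.continuousWithinAt)
    (fun t ht => (hd t (interior_subset ht)).differentiableAt.differentiableWithinAt)
    (fun t ht => by
      rw [(hd t (interior_subset ht)).deriv]
      have := mul_nonneg (sub_nonneg.2 (hK t (interior_subset ht)))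
        (Real.exp_pos (-K * (t - b))).le
      linarith)
    (left_mem_Icc.2 hab) (right_mem_Icc.2 hab) hab
  have e : -K * (a - b) = K * (b - a) := by ring
  simpa [e] using hmono

theorem mem_closedBall_of_exit_value_bound {E : Type*} [NormedAddCommGroup E]
    {ψ : E → ℝ} {p₀ : E} {R m r : ℝ} (hR : 0 < R) (hm : 0 < m) (hr : 0 ≤ r)
    (hrR : 2 * r < m * R ^ 2)
    (hle : ∀ p ∈ closedBall p₀ R, m * ‖p - p₀‖ ^ 2 ≤ ψ p) {γ : ℝ → E} {t₀ : ℝ}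
    (hcont : ContinuousOn γ (Ici t₀)) (h0 : γ t₀ ∈ closedBall p₀ R) (hψ0 : ψ (γ t₀) ≤ r)
    (hest : ∀ t ≥ t₀, (∀ s ∈ Icc t₀ t, γ s ∈ closedBall p₀ R) → ψ (γ t) ≤ 2 * r) :
    ∀ t ≥ t₀, γ t ∈ closedBall p₀ R := by
  intro t ht
  by_contra hout
  set f : ℝ → ℝ := fun s => ‖γ s - p₀‖ with hf
  have hfc : ContinuousOn f (Icc t₀ t) :=
    ((hcont.mono Icc_subset_Ici_self).sub continuousOn_const).norm
  have ht' : R < f t := by simpa [hf, dist_eq_norm] using hout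
  have hf0 : f t₀ < R := by
    have h := hle _ h0
    have : f t₀ ^ 2 < R ^ 2 := by
      refine lt_of_mul_lt_mul_left ?_ hm.le
      simp only [hf]
      linarith
    exact lt_of_pow_lt_pow_left₀ 2 hR.le this
  have hcomp : IsCompact (Icc t₀ t ∩ f ⁻¹' Ici R) :=
    isCompact_Icc.of_isClosed_subset (hfc.preimage_isClosed_of_isClosed isClosed_Icc isClosed_Ici)
      inter_subset_left
  obtain ⟨τ, ⟨hτ, hτR⟩, hleast⟩ := hcomp.exists_isLeast ⟨t, right_mem_Icc.2 ht, ht'.le⟩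
  obtain ⟨s, hs, hsR⟩ := intermediate_value_Icc hτ.1 (hfc.mono (Icc_subset_Icc_right hτ.2))
    ⟨hf0.le, hτR⟩
  have hsτ : s = τ := le_antisymm hs.2 (hleast ⟨⟨hs.1, hs.2.trans hτ.2⟩, hsR.ge⟩)
  subst hsτ
  have hin : ∀ s' ∈ Icc t₀ s, γ s' ∈ closedBall p₀ R := by
    intro s' hs'
    rw [mem_closedBall, dist_eq_norm]
    rcases hs'.2.eq_or_lt with rfl | hlt
    · exact hsR.le
    · by_contra hc
      exact hlt.not_ge (hleast ⟨⟨hs'.1, hs'.2.trans hτ.2⟩, (not_le.1 hc).le⟩)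
  have h1 := hest s hτ.1 hin
  have h2 := hle _ (hin s (right_mem_Icc.2 hτ.1))
  have h3 : ‖γ s - p₀‖ = R := hsR
  rw [h3] at h2
  linarith

theorem connectedComponentIn_subset_ball {E : Type*} [NormedAddCommGroup E] [NormedSpace ℝ E]
    {S : Set E} {p₀ : E} {R : ℝ} (hR : 0 < R) (hp₀ : p₀ ∈ S)
    (hS : ∀ p ∈ S, ‖p - p₀‖ ≠ R) : connectedComponentIn S p₀ ⊆ ball p₀ R := by
  refine isPreconnected_connectedComponentIn.subset_of_closure_inter_subset isOpen_ball
    ⟨p₀, mem_connectedComponentIn hp₀, mem_ball_self hR⟩ ?_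
  rintro p ⟨hp, hpS⟩
  have h1 := mem_closedBall.1 (closure_ball_subset_closedBall hp)
  have h2 := hS p (connectedComponentIn_subset _ _ hpS)
  rw [dist_eq_norm] at h1
  rw [mem_ball, dist_eq_norm]
  exact lt_of_le_of_ne h1 h2

theorem eventually_abs_fderiv_controlled_le {K E : Type*} [Fintype K] [NormedAddCommGroup E]
    [NormedSpace ℝ E] {B : K → E → E} (hB : ∀ j, ContDiff ℝ (⊤ : ℕ∞) (B j)) {ψ : E → ℝ}
    (hψ : ContDiff ℝ (⊤ : ℕ∞) ψ) (hnn : ∀ p, 0 ≤ ψ p) {p₀ : E} (hψ0 : ψ p₀ = 0) {h₁ h₂ : ℝ → ℝ}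
    {L : ℝ≥0} {δ : ℝ} (hδ : 0 < δ) (h10 : h₁ 0 = 0) (h20 : h₂ 0 = 0)
    (hL₁ : LipschitzOnWith L h₁ (Iic δ)) (hL₂ : LipschitzOnWith L h₂ (Iic δ))
    {u : K × Bool → ℝ → ℝ} (hu : ∀ i, ∃ C : ℝ, ∀ t, |u i t| ≤ C) :
    ∃ C : ℝ, ∀ᶠ p in 𝓝 p₀, ∀ t,
      |fderiv ℝ ψ p (∑ i, u i t • outputField B ψ h₁ h₂ i p)| ≤ C * ψ p := by
  choose Cu hu using hu
  refine ⟨∑ i : K × Bool, Cu i * (L * (|fderiv ℝ ψ p₀ (B i.1 p₀)| + 1)), ?_⟩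
  have hbd : ∀ᶠ p in 𝓝 p₀, ∀ k, |fderiv ℝ ψ p (B k p)| < |fderiv ℝ ψ p₀ (B k p₀)| + 1 := by
    refine eventually_all.2 fun k => ?_
    have hc : Continuous fun p => |fderiv ℝ ψ p (B k p)| :=
      ((hψ.continuous_fderiv (by simp)).clm_apply (hB k).continuous).abs
    exact hc.continuousAt.eventually_lt continuousAt_const (by simp)
  have hsmall : ∀ᶠ p in 𝓝 p₀, ψ p < δ :=
    hψ.continuous.continuousAt.eventually_lt continuousAt_const (by simpa [hψ0] using hδ)
  have hlin : ∀ b : Bool, ∀ y ∈ Icc 0 δ, |cond b (h₂ y) (h₁ y)| ≤ L * y := by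
    intro b y hy
    cases b
    · have := hL₁.dist_le_mul y hy.2 0 hδ.le
      simpa [h10, Real.dist_eq, abs_of_nonneg hy.1] using this
    · have := hL₂.dist_le_mul y hy.2 0 hδ.le
      simpa [h20, Real.dist_eq, abs_of_nonneg hy.1] using this
  filter_upwards [hbd, hsmall] with p hp hpδ t
  rw [map_sum, Finset.sum_mul]
  refine (Finset.abs_sum_le_sum_abs _ _).trans (Finset.sum_le_sum fun i _ => ?_)
  rw [outputField, map_smul, map_smul, smul_eq_mul, smul_eq_mul, abs_mul, abs_mul, mul_assoc]
  have hLp : 0 ≤ L * ψ p := mul_nonneg L.2 (hnn p)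
  have h1 := mul_le_mul (hlin i.2 (ψ p) ⟨hnn p, hpδ.le⟩) (hp i.1).le (abs_nonneg _) hLp
  refine (mul_le_mul (hu i t) h1 (by positivity) ((abs_nonneg _).trans (hu i t))).trans_eq ?_
  ring

theorem clLoop_eq_sum {n μ : ℕ} (B : Fin μ → EuclideanSpace ℝ (Fin n) → EuclideanSpace ℝ (Fin n))
    (ψ : EuclideanSpace ℝ (Fin n) → ℝ) (h₁ h₂ : ℝ → ℝ) (ω φv : Fin μ → ℝ) (t : ℝ)
    (p : EuclideanSpace ℝ (Fin n)) :
    clLoop B ψ h₁ h₂ ω φv t p =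
      ∑ i, sinusoidalInput ω φv i t • outputField B ψ h₁ h₂ i p := by
  simp only [clLoop, Fintype.sum_prod_type, Fintype.sum_bool, sinusoidalInput, outputField,
    cond_true, cond_false, sub_zero]
  refine Finset.sum_congr rfl fun k _ => ?_
  rw [show ω k * t + (φv k - Real.pi / 2) = ω k * t + φv k - Real.pi / 2 by ring,
    Real.cos_sub_pi_div_two, smul_smul, smul_smul, ← add_smul]
  congr 1
  ring

/-- Extremum seeking near a nondegenerate minimum, for initial states in a small ball with small
output value. -/
theorem exists_local_decay {K E : Type*} [Fintype K] [NormedAddCommGroup E]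
    [InnerProductSpace ℝ E] [FiniteDimensional ℝ E] {B : K → E → E}
    (hB : ∀ j, ContDiff ℝ (⊤ : ℕ∞) (B j)) {ψ : E → ℝ} (hψ : ContDiff ℝ (⊤ : ℕ∞) ψ)
    (hnn : ∀ p, 0 ≤ ψ p) {p₀ : E} (hψ0 : ψ p₀ = 0) (hpos : ∀ᶠ p in 𝓝[≠] p₀, 0 < ψ p)
    (hhess : ∀ v, v ≠ 0 → 0 < fderiv ℝ (fderiv ℝ ψ) p₀ v v)
    (hspan : Submodule.span ℝ (Set.range fun k => B k p₀) = ⊤)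
    {h₁ h₂ : ℝ → ℝ} (hh : GoodPair h₁ h₂) {ω : K → ℝ} (φ : K → ℝ) (hω : ∀ k, 0 < ω k)
    (hinj : Function.Injective ω) :
    ∃ c > (0 : ℝ), ∃ R > (0 : ℝ), ∃ r > (0 : ℝ), (∀ p, ‖p - p₀‖ = R → r < ψ p) ∧
      ∀ (t₀ : ℝ) (x₀ : E), x₀ ∈ closedBall p₀ R → ψ x₀ ≤ r →
        (∃ γ : ℝ → E, γ t₀ = x₀ ∧ ∀ t ≥ t₀,
          HasDerivAt γ (∑ i, sinusoidalInput ω φ i t • outputField B ψ h₁ h₂ i (γ t)) t) ∧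
        ∀ γ : ℝ → E, γ t₀ = x₀ → (∀ t ≥ t₀,
            HasDerivAt γ (∑ i, sinusoidalInput ω φ i t • outputField B ψ h₁ h₂ i (γ t)) t) →
          Tendsto γ atTop (𝓝 p₀) ∧
          ∀ t ≥ t₀, ψ (γ t) ≤ 2 * ψ x₀ / (1 + c * ψ x₀ * (t - t₀)) := by
  have h1 : fderiv ℝ ψ p₀ = 0 := by
    have : IsLocalMin ψ p₀ := Eventually.of_forall fun p => hψ0 ▸ hnn p
    exact this.fderiv_eq_zero
  obtain ⟨m, hm, hle⟩ := exists_pos_mul_sq_le_of_hessian_pos hψ hψ0 h1 hhess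
  obtain ⟨m', hm', hle'⟩ := exists_pos_mul_sq_le_sum_fderiv_sq hB hψ h1 hhess hspan
  obtain ⟨c, hc, Ω, hΩ, hrate⟩ :=
    exists_averaging_rate hB hψ hψ0 h1 hpos hm hle hm' hle' hh φ hω hinj
  have hub : ∀ i, ∃ C, ∀ t, |sinusoidalInput ω φ i t| ≤ C := fun i =>
    ⟨_, abs_sinusoidalInput_le ω φ i⟩
  obtain ⟨L, δ, hδ, h10, h20, hL₁, hL₂⟩ : ∃ L : ℝ≥0, ∃ δ > (0 : ℝ), h₁ 0 = 0 ∧ h₂ 0 = 0 ∧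
      LipschitzOnWith L h₁ (Iic δ) ∧ LipschitzOnWith L h₂ (Iic δ) := by
    obtain ⟨a₁, a₂, -, c₁, c₂, ⟨C₀, δ₀, hδ₀, b₀⟩, ⟨C₁, δ₁, hδ₁, b₁⟩, -⟩ := hh
    obtain ⟨K₁, η₁, hη₁, hK₁⟩ := lipschitzOnWith_Iic_of_deriv_bounded a₁ c₁
      ⟨C₀, δ₀, hδ₀, fun y hy => (b₀ y hy).1⟩ ⟨C₁, δ₁, hδ₁, fun y hy => (b₁ y hy).1⟩
    obtain ⟨K₂, η₂, hη₂, hK₂⟩ := lipschitzOnWith_Iic_of_deriv_bounded a₂ c₂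
      ⟨C₀, δ₀, hδ₀, fun y hy => (b₀ y hy).2⟩ ⟨C₁, δ₁, hδ₁, fun y hy => (b₁ y hy).2⟩
    exact ⟨max K₁ K₂, min η₁ η₂, lt_min hη₁ hη₂, a₁ 0 le_rfl, a₂ 0 le_rfl,
      (hK₁ _ (min_le_left _ _)).weaken (le_max_left _ _),
      (hK₂ _ (min_le_right _ _)).weaken (le_max_right _ _)⟩
  obtain ⟨C, hC⟩ := eventually_abs_fderiv_controlled_le hB hψ hnn hψ0 hδ h10 h20 hL₁ hL₂ hub
  have hsmall : ∀ᶠ p in 𝓝 p₀, ψ p < δ :=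
    hψ.continuous.continuousAt.eventually_lt continuousAt_const (by simpa [hψ0] using hδ)
  obtain ⟨R, hR, hball⟩ := nhds_basis_closedBall.eventually_iff.1
    (hle.and ((hpos.and hΩ |> eventually_nhdsWithin_iff.1).and (hC.and hsmall)))
  have hleR : ∀ p ∈ closedBall p₀ R, m * ‖p - p₀‖ ^ 2 ≤ ψ p := fun p hp => (hball hp).1
  have hmR : 0 < m * R ^ 2 := by positivity
  refine ⟨c, hc, R, hR, m * R ^ 2 / 4, by positivity, fun p hp => ?_, fun t₀ x₀ hx₀ hx₀r => ?_⟩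
  · have := hleR p (by rw [mem_closedBall, dist_eq_norm, hp])
    rw [hp] at this
    linarith
  set X := fun (t : ℝ) (p : E) => ∑ i, sinusoidalInput ω φ i t • outputField B ψ h₁ h₂ i p with hX
  have hest : ∀ (γ : ℝ → E) (t : ℝ), γ t₀ = x₀ → t₀ ≤ t →
      (∀ s ∈ Icc t₀ t, γ s ∈ closedBall p₀ R) → (∀ s ∈ Icc t₀ t, HasDerivAt γ (X s (γ s)) s) →
      ψ (γ t) ≤ 2 * ψ x₀ / (1 + c * ψ x₀ * (t - t₀)) := by
    intro γ t h0 ht hin hγ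
    have hd : ∀ s ∈ Icc t₀ t, HasDerivAt (fun s => ψ (γ s)) (fderiv ℝ ψ (γ s) (X s (γ s))) s :=
      fun s hs => ((hψ.differentiable (by simp) (γ s)).hasFDerivAt).comp_hasDerivAt s (hγ s hs)
    have hdb : ∀ s ∈ Icc t₀ t, |fderiv ℝ ψ (γ s) (X s (γ s))| ≤ C * ψ (γ s) := fun s hs =>
      (hball (hin s hs)).2.2.1 s
    rcases (hnn x₀).eq_or_lt with hz | hz
    · have h := exp_mul_le_of_mul_le_deriv ht (fun s hs => (hd s hs).neg) (K := C)
        (fun s hs => by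
          have := (abs_le.1 (hdb s hs)).2
          simp only [Pi.neg_apply]
          linarith)
      simp only [Pi.neg_apply, h0, ← hz] at h
      rw [← hz]
      simpa using h
    · rw [← h0]
      refine hrate γ t₀ t ht (fun s hs => ?_) hγ
      have hsub : Icc t₀ s ⊆ Icc t₀ t := Icc_subset_Icc_right hs.2
      have h := exp_mul_le_of_mul_le_deriv hs.1 (fun s hs => hd s (hsub hs)) (K := -C)
        (fun s hs => by
          have := (abs_le.1 (hdb s (hsub hs))).1
          linarith)
      rw [h0] at h
      have hps : 0 < ψ (γ s) := (mul_pos hz (Real.exp_pos _)).trans_le h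
      have hne : γ s ≠ p₀ := fun e => by simp [e, hψ0] at hps
      exact ((hball (hin s hs)).2.1 hne).2
  have htrap : ∀ γ : ℝ → E, γ t₀ = x₀ → ContinuousOn γ (Ici t₀) →
      (∀ s ≥ t₀, γ s ∈ closedBall p₀ R → HasDerivAt γ (X s (γ s)) s) →
      ∀ t ≥ t₀, γ t ∈ closedBall p₀ R := by
    intro γ h0 hcont hγ
    refine mem_closedBall_of_exit_value_bound hR hm (r := m * R ^ 2 / 4) (by positivity)
      (by linarith) hleR hcont (h0 ▸ hx₀) (h0 ▸ hx₀r) fun t ht hin => ?_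
    have hb := hest γ t h0 ht hin fun s hs => hγ s hs.1 (hin s hs)
    refine hb.trans ((div_le_self (by linarith [hnn x₀]) ?_).trans (by linarith))
    have := mul_nonneg (mul_nonneg hc.le (hnn x₀)) (sub_nonneg.2 ht)
    linarith
  constructor
  · have hg : ∀ i : K × Bool, ∃ g : E → E, (∃ L, LipschitzWith L g) ∧
        (∃ L : ℝ≥0, ∀ p, ‖g p‖ ≤ L) ∧ EqOn g (outputField B ψ h₁ h₂ i) (closedBall p₀ R) := by
      have hleδ : ∀ p ∈ closedBall p₀ R, ψ p ≤ δ := fun p hp => (hball hp).2.2.2.le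
      rintro ⟨k, _ | _⟩
      · exact exists_bounded_lipschitz_eqOn_closedBall hψ (hB k) hL₁ hR hleδ
      · exact exists_bounded_lipschitz_eqOn_closedBall hψ (hB k) hL₂ hR hleδ
    choose g hgL hgb hgeq using hg
    obtain ⟨γ, h0, hγ⟩ := exists_global_solution_controlled hgL hgb
      (u := sinusoidalInput ω φ) (fun i => by unfold sinusoidalInput; fun_prop) hub t₀ x₀
    have hγX : ∀ s, γ s ∈ closedBall p₀ R → HasDerivAt γ (X s (γ s)) s := fun s hs => by
      have h := hγ s
      simp only [fun i => hgeq i hs] at h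
      exact h
    exact ⟨γ, h0, fun t ht => hγX t (htrap γ h0
      (fun s _ => (hγ s).continuousAt.continuousWithinAt) (fun s _ hs => hγX s hs) t ht)⟩
  · intro γ h0 hγ
    have hin := htrap γ h0 (fun s hs => (hγ s hs).continuousAt.continuousWithinAt)
      fun s hs _ => hγ s hs
    have hbound : ∀ t ≥ t₀, ψ (γ t) ≤ 2 * ψ x₀ / (1 + c * ψ x₀ * (t - t₀)) := fun t ht =>
      hest γ t h0 ht (fun s hs => hin s hs.1) fun s hs => hγ s hs.1
    refine ⟨?_, hbound⟩
    have hlim : Tendsto (fun t => 2 * ψ x₀ / (1 + c * ψ x₀ * (t - t₀))) atTop (𝓝 0) := by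
      rcases (hnn x₀).eq_or_lt with hz | hz
      · simp [← hz]
      · exact tendsto_const_nhds.div_atTop (tendsto_atTop_add_const_left _ _
          ((tendsto_atTop_add_const_right _ _ tendsto_id).const_mul_atTop (mul_pos hc hz)))
    have hsq : Tendsto (fun t => ‖γ t - p₀‖ ^ 2) atTop (𝓝 0) := by
      refine squeeze_zero' (Eventually.of_forall fun t => by positivity) ?_
        (by simpa using hlim.div_const m)
      filter_upwards [eventually_ge_atTop t₀] with t ht
      rw [le_div_iff₀ hm, mul_comm]
      exact (hleR _ (hin t ht)).trans (hbound t ht)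
    rw [tendsto_iff_norm_sub_tendsto_zero]
    simpa using hsq.sqrt

/-- Extremum seeking for a control-affine system under the output-feedback
law `u_k = u_{(k,1)}(t)h₁(ψ(p)) + u_{(k,2)}(t)h₂(ψ(p))`: if `ψ(p*) = 0` is a strict local
minimum with positive definite second derivative and the control vector fields span `ℝⁿ`
near `p*`, then there are `c, r > 0` such that for every initial time `t₀` and every `p₀` in
the connected component of `{ψ ≤ r}` containing `p*`, the maximal solution of the
closed-loop system exists on `[t₀,∞)`, converges to `p*`, and satisfies
`ψ(γ(t)) ≤ 2ψ(p₀)/(1 + c·ψ(p₀)·(t − t₀))` for `t ≥ t₀`. -/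
theorem stmt_19 {n μ : ℕ} (hn : 0 < n) (hμ : 0 < μ)
    (B : Fin μ → EuclideanSpace ℝ (Fin n) → EuclideanSpace ℝ (Fin n))
    (hB : ∀ k, ContDiff ℝ (⊤ : ℕ∞) (B k))
    (ψ : EuclideanSpace ℝ (Fin n) → ℝ) (hψ : ContDiff ℝ (⊤ : ℕ∞) ψ)
    (hψ_nonneg : ∀ p, 0 ≤ ψ p)
    (h₁ h₂ : ℝ → ℝ) (hh : GoodPair h₁ h₂)
    (ω φv : Fin μ → ℝ) (hω : ∀ k, 0 < ω k) (hω_distinct : Function.Injective ω)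
    (pstar : EuclideanSpace ℝ (Fin n)) (hψ0 : ψ pstar = 0)
    (hstrict : ∃ V ∈ nhds pstar, ∀ p ∈ V, p ≠ pstar → 0 < ψ p)
    (hposdef : ∀ v : EuclideanSpace ℝ (Fin n), v ≠ 0 →
      0 < iteratedFDeriv ℝ 2 ψ pstar ![v, v])
    (hspan : ∃ W ∈ nhds pstar, ∀ p ∈ W,
      Submodule.span ℝ (Set.range fun k => B k p) = ⊤) :
    ∃ c > (0 : ℝ), ∃ r > (0 : ℝ), ∀ t₀ : ℝ,
      ∀ p₀ ∈ connectedComponentIn {p : EuclideanSpace ℝ (Fin n) | ψ p ≤ r} pstar,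
        (∃ γ : ℝ → EuclideanSpace ℝ (Fin n), γ t₀ = p₀ ∧
          ∀ t ≥ t₀, HasDerivAt γ (clLoop B ψ h₁ h₂ ω φv t (γ t)) t) ∧
        ∀ γ : ℝ → EuclideanSpace ℝ (Fin n), γ t₀ = p₀ →
          (∀ t ≥ t₀, HasDerivAt γ (clLoop B ψ h₁ h₂ ω φv t (γ t)) t) →
          Filter.Tendsto γ Filter.atTop (nhds pstar) ∧
          ∀ t ≥ t₀, ψ (γ t) ≤ 2 * ψ p₀ / (1 + c * ψ p₀ * (t - t₀)) := by
  have hpos : ∀ᶠ p in 𝓝[≠] pstar, 0 < ψ p := by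
    obtain ⟨V, hV, hVpos⟩ := hstrict
    filter_upwards [nhdsWithin_le_nhds hV, self_mem_nhdsWithin] with p hp hne using hVpos p hp hne
  have hhess : ∀ v, v ≠ 0 → 0 < fderiv ℝ (fderiv ℝ ψ) pstar v v := fun v hv => by
    simpa [iteratedFDeriv_two_apply] using hposdef v hv
  have hspan₀ : Submodule.span ℝ (Set.range fun k => B k pstar) = ⊤ := by
    obtain ⟨W, hW, hWspan⟩ := hspan
    exact hWspan _ (mem_of_mem_nhds hW)
  obtain ⟨c, hc, R, hR, r, hr, hsphere, hloc⟩ :=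
    exists_local_decay hB hψ hψ_nonneg hψ0 hpos hhess hspan₀ hh φv hω hω_distinct
  refine ⟨c, hc, r, hr, fun t₀ p₀ hp₀ => ?_⟩
  have hsub := connectedComponentIn_subset_ball (S := {p | ψ p ≤ r}) hR
    (show ψ pstar ≤ r by rw [hψ0]; exact hr.le) fun p hp hpR => (hsphere p hpR).not_ge hp
  simp only [clLoop_eq_sum]
  exact hloc t₀ p₀ (ball_subset_closedBall (hsub hp₀))
    (show p₀ ∈ {p | ψ p ≤ r} from connectedComponentIn_subset _ _ hp₀)
end
end
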